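/- arXiv:2111.10122 — 3 statements merged into one kernel-verified Lean document; each statement's English description precedes it below -/
import Mathlib

section
/- Let Z = ℓ₁ ⊕₂ ℝ and let F : B_Z → B_Z be a non-expansive bijection of the closed unit ball onto itself. Then for every m ∈ ℕ there exist θ ∈ {−1, 1} and n ∈ ℕ such that F⁻¹(e_m, 0) = (θ·e_n, 0). -/
/-- The real sequence space ℓ₁. -/
noncomputable abbrev Ell1 : Type := lp (fun _ : ℕ => ℝ) 1

/-- The space Z = ℓ₁ ⊕₂ ℝ, with norm ‖(x,t)‖ = √(‖x‖₁² + t²). -/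
noncomputable abbrev Z : Type := WithLp 2 (Ell1 × ℝ)

/-- The m-th canonical basis vector of ℓ₁. -/
noncomputable def e (m : ℕ) : Ell1 := lp.single 1 m (1 : ℝ)

/-- The element (x, t) of Z = ℓ₁ ⊕₂ ℝ. -/
noncomputable def zmk (x : Ell1) (t : ℝ) : Z := (WithLp.equiv 2 (Ell1 × ℝ)).symm (x, t)


lemma aux_e_apply (m j : ℕ) : (e m : Ell1) j = if j = m then 1 else 0 := by
  unfold e
  rw [lp.coeFn_single, Pi.single_apply]

lemma aux_dec0 (x : Ell1) (m : ℕ) : ‖x‖ = |x m| + ‖x - x m • e m‖ := by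
  have h := lp.norm_compl_sum_single (p := 1) (E := fun _ : ℕ => ℝ) (by simp) x {m}
  have h2 : lp.single (E := fun _ : ℕ => ℝ) 1 m (x m) = x m • e m := by
    ext j
    rw [lp.coeFn_smul, Pi.smul_apply, aux_e_apply, lp.coeFn_single, Pi.single_apply]
    simp
  simp only [Finset.sum_singleton, h2] at h
  simp at h
  linarith

lemma aux_dec (x : Ell1) (m : ℕ) (c : ℝ) :
    ‖x + c • e m‖ = |x m + c| + ‖x - x m • e m‖ := by
  have h := aux_dec0 (x + c • e m) m
  have h1 : (x + c • e m : Ell1) m = x m + c := by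
    rw [lp.coeFn_add, Pi.add_apply, lp.coeFn_smul, Pi.smul_apply, aux_e_apply]; simp
  rw [h1] at h
  rw [h]
  congr 2
  rw [add_smul]; abel

lemma aux_dec2 (x : Ell1) (i j : ℕ) (hij : i ≠ j) (a b : ℝ) :
    ‖x + (a • e i + b • e j)‖ = |x i + a| + |x j + b| + ‖(x - x j • e j) - x i • e i‖ := by
  have h1 : (x + a • e i : Ell1) j = x j := by
    rw [lp.coeFn_add, Pi.add_apply, lp.coeFn_smul, Pi.smul_apply, aux_e_apply]; simp [hij.symm]
  have h2 : (x - x j • e j : Ell1) i = x i := by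
    rw [lp.coeFn_sub, Pi.sub_apply, lp.coeFn_smul, Pi.smul_apply, aux_e_apply]; simp [hij]
  have h := aux_dec (x + a • e i) j b
  have h' := aux_dec (x - x j • e j) i a
  rw [h1] at h
  rw [h2] at h'
  have h3 : x + a • e i - x j • e j = x - x j • e j + a • e i := by abel
  rw [← add_assoc, h, h3, h']
  ring

lemma aux_nsq (w : Z) : ‖w‖ ^ 2 = ‖w.fst‖ ^ 2 + w.snd ^ 2 := by
  rw [WithLp.prod_norm_sq_eq_of_L2]; simp

lemma aux_norm_e (m : ℕ) : ‖e m‖ = 1 := by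
  unfold e
  rw [lp.norm_single (by simp)]; simp

lemma aux_zfst (x : Ell1) (t : ℝ) : (zmk x t).fst = x := rfl
lemma aux_zsnd (x : Ell1) (t : ℝ) : (zmk x t).snd = t := rfl

lemma aux_zext {u v : Z} (h1 : u.fst = v.fst) (h2 : u.snd = v.snd) : u = v := by
  apply (WithLp.equiv 2 (Ell1 × ℝ)).injective
  exact Prod.ext h1 h2

lemma aux_A (m : ℕ) (u : Z) (h1 : ‖u - zmk (e m) 0‖ ≤ 1) (h2 : ‖u + zmk (e m) 0‖ ≤ 1) :
    u = 0 := by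
  have k1 : ‖u - zmk (e m) 0‖ ^ 2 ≤ 1 := pow_le_one₀ (norm_nonneg _) h1
  have k2 : ‖u + zmk (e m) 0‖ ^ 2 ≤ 1 := pow_le_one₀ (norm_nonneg _) h2
  rw [aux_nsq, WithLp.sub_fst, WithLp.sub_snd, aux_zfst, aux_zsnd] at k1
  rw [aux_nsq, WithLp.add_fst, WithLp.add_snd, aux_zfst, aux_zsnd] at k2
  have d1 := aux_dec u.fst m (-1)
  have d2 := aux_dec u.fst m 1
  have d0 := aux_dec0 u.fst m
  rw [neg_one_smul, ← sub_eq_add_neg] at d1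
  rw [one_smul] at d2
  rw [d1] at k1
  rw [d2] at k2
  set R := ‖u.fst - u.fst m • e m‖
  have hR : 0 ≤ R := norm_nonneg _
  set a : ℝ := u.fst m
  set s : ℝ := u.snd
  have b1 : |a + -1| + R ≤ 1 := by
    apply abs_le_of_sq_le_sq' _ zero_le_one |>.2
    nlinarith [sq_nonneg s]
  have b2 : |a + 1| + R ≤ 1 := by
    apply abs_le_of_sq_le_sq' _ zero_le_one |>.2
    nlinarith [sq_nonneg s]
  have c1 := neg_abs_le (a + -1)
  have c2 := le_abs_self (a + 1)
  have ha : a = 0 := by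
    linarith
  have hR0 : R = 0 := by linarith
  have hs : s = 0 := by
    rw [ha, hR0] at k1
    norm_num at k1
    nlinarith [sq_nonneg s]
  apply aux_zext
  · rw [ha, hR0] at d0
    simpa using d0
  · exact hs

/-- Extremality of the first coordinate. -/
lemma aux_B (w : Z) (hw : ‖w‖ ≤ 1) (h : ∀ p : Z, ‖p‖ ≤ 1 → ‖p - w‖ ≤ 1 → ‖p + w‖ ≤ 1 → p = 0)
    (i j : ℕ) (hij : i ≠ j) (hi : w.fst i ≠ 0) : w.fst j = 0 := by
  by_contra hj
  have hw2 : ‖w‖ ^ 2 ≤ 1 := pow_le_one₀ (norm_nonneg _) hw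
  have hn : ‖w.fst‖ ≤ 1 := by
    rw [aux_nsq] at hw2
    apply abs_le_of_sq_le_sq' _ zero_le_one |>.2
    nlinarith [sq_nonneg w.snd]
  set x : Ell1 := w.fst with hx
  set al : ℝ := x i * |x j| with hal
  set be : ℝ := -(x j * |x i|) with hbe
  have hxi : |x i| ≤ 1 := by
    have := aux_dec0 x i
    linarith [norm_nonneg (x - x i • e i)]
  have hxj : |x j| ≤ 1 := by
    have := aux_dec0 x j
    linarith [norm_nonneg (x - x j • e j)]
  have e1 : |x i + al| = |x i| * (1 + |x j|) := by
    rw [hal, ← mul_one_add, abs_mul, abs_of_nonneg (by positivity : 0 ≤ 1 + |x j|)]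
  have e2 : |x j + be| = |x j| * (1 - |x i|) := by
    rw [hbe, ← sub_eq_add_neg, ← mul_one_sub, abs_mul, abs_of_nonneg (by linarith : 0 ≤ 1 - |x i|)]
  have e3 : |x i + -al| = |x i| * (1 - |x j|) := by
    rw [hal, ← sub_eq_add_neg, ← mul_one_sub, abs_mul, abs_of_nonneg (by linarith : 0 ≤ 1 - |x j|)]
  have e4 : |x j + -be| = |x j| * (1 + |x i|) := by
    rw [hbe, neg_neg, ← mul_one_add, abs_mul, abs_of_nonneg (by positivity : 0 ≤ 1 + |x i|)]
  have n0 := aux_dec2 x i j hij 0 0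
  have n1 := aux_dec2 x i j hij al be
  have n2 := aux_dec2 x i j hij (-al) (-be)
  simp only [zero_smul, add_zero] at n0
  have q1 : ‖x + (al • e i + be • e j)‖ = ‖x‖ := by
    rw [n1, n0, e1, e2]; ring
  have q2 : ‖x + ((-al) • e i + (-be) • e j)‖ = ‖x‖ := by
    rw [n2, n0, e3, e4]; ring
  set p : Z := zmk (al • e i + be • e j) 0 with hp
  have r1 : ‖p + w‖ ≤ 1 := by
    apply abs_le_of_sq_le_sq' _ zero_le_one |>.2
    rw [aux_nsq, WithLp.add_fst, WithLp.add_snd, hp, aux_zfst, aux_zsnd, ← hx, add_comm _ x, q1]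
    rw [aux_nsq] at hw2
    simpa using hw2
  have r2 : ‖p - w‖ ≤ 1 := by
    rw [norm_sub_rev]
    apply abs_le_of_sq_le_sq' _ zero_le_one |>.2
    have : x - (al • e i + be • e j) = x + ((-al) • e i + (-be) • e j) := by
      clear_value al be
      module
    rw [aux_nsq, WithLp.sub_fst, WithLp.sub_snd, hp, aux_zfst, aux_zsnd, ← hx, this, q2]
    rw [aux_nsq] at hw2
    simpa using hw2
  have r3 : ‖p‖ ≤ 1 := by
    have : p = (1/2 : ℝ) • ((p + w) + (p - w)) := by
      rw [add_add_sub_cancel, ← two_smul ℝ p, smul_smul]; norm_num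
    rw [this, norm_smul]
    have := norm_add_le (p + w) (p - w)
    rw [Real.norm_of_nonneg (by norm_num)]
    linarith
  have hp0 := h p r3 r2 r1
  have hf : al • e i + be • e j = (0 : Ell1) := by
    have := congrArg (fun z : Z => z.fst) hp0
    simpa [hp, aux_zfst] using this
  have hfi : (al • e i + be • e j : Ell1) i = 0 := by rw [hf]; rfl
  rw [lp.coeFn_add, Pi.add_apply, lp.coeFn_smul, Pi.smul_apply, lp.coeFn_smul, Pi.smul_apply,
    aux_e_apply, aux_e_apply] at hfi
  simp [hij, hal, hi, hj] at hfi

lemma aux_F0 (F : Z → Z) (hbij : Set.BijOn F (Metric.closedBall 0 1) (Metric.closedBall 0 1))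
    (hne : ∀ u v : Z, ‖u‖ ≤ 1 → ‖v‖ ≤ 1 → ‖F u - F v‖ ≤ ‖u - v‖) : F 0 = 0 := by
  by_contra h0
  have hpos : 0 < ‖F 0‖ := norm_pos_iff.2 h0
  have hy : -(‖F 0‖⁻¹ • F 0) ∈ Metric.closedBall (0 : Z) 1 := by
    rw [mem_closedBall_zero_iff, norm_neg, norm_smul, norm_inv, norm_norm,
      inv_mul_cancel₀ hpos.ne']
  obtain ⟨x, hx, hxy⟩ := hbij.surjOn hy
  rw [mem_closedBall_zero_iff] at hx
  have h := hne x 0 hx (by simp)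
  rw [hxy, sub_zero] at h
  have : -(‖F 0‖⁻¹ • F 0) - F 0 = -((‖F 0‖⁻¹ + 1) • F 0) := by
    rw [add_smul, one_smul]; abel
  rw [this, norm_neg, norm_smul, Real.norm_of_nonneg (by positivity), add_mul,
    inv_mul_cancel₀ hpos.ne'] at h
  linarith

lemma aux_C (w w' : Z) (hw : ‖w‖ ≤ 1) (hw' : ‖w'‖ ≤ 1) (h1 : 2 ≤ ‖w - w'‖) (h2 : 2 ≤ ‖w + w'‖) :
    ‖w.fst‖ = 1 ∧ w.snd = 0 := by
  have a1 : ‖w‖ ^ 2 ≤ 1 := pow_le_one₀ (norm_nonneg _) hw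
  have a2 : ‖w'‖ ^ 2 ≤ 1 := pow_le_one₀ (norm_nonneg _) hw'
  have b1 : 4 ≤ ‖w - w'‖ ^ 2 := by nlinarith
  have b2 : 4 ≤ ‖w + w'‖ ^ 2 := by nlinarith
  rw [aux_nsq] at a1 a2 b1 b2
  rw [WithLp.sub_fst, WithLp.sub_snd] at b1
  rw [WithLp.add_fst, WithLp.add_snd] at b2
  have c1 := pow_le_pow_left₀ (norm_nonneg _) (norm_sub_le w.fst w'.fst) 2
  have c2 := pow_le_pow_left₀ (norm_nonneg _) (norm_add_le w.fst w'.fst) 2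
  have p1 : 0 ≤ ‖w.fst‖ := norm_nonneg _
  have p2 : 0 ≤ ‖w'.fst‖ := norm_nonneg _
  generalize ‖w.fst‖ = X at *
  generalize ‖w'.fst‖ = Y at *
  generalize w.snd = s at *
  generalize w'.snd = t at *
  have hXY : 1 ≤ X * Y := by nlinarith
  have hX : X ≤ 1 := by nlinarith [sq_nonneg s]
  have hY : Y ≤ 1 := by nlinarith [sq_nonneg t]
  have hX1 : X = 1 := by nlinarith
  subst hX1
  exact ⟨rfl, by nlinarith [sq_nonneg s]⟩

theorem preimage_of_basis_vector_ell1_sum2_real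
    (B : Set Z) (hB : B = Metric.closedBall (0 : Z) 1)
    (F : Z → Z) (hbij : Set.BijOn F B B) (hne : LipschitzOnWith 1 F B) :
    ∀ m : ℕ, ∃ (θ : ℝ) (n : ℕ), (θ = 1 ∨ θ = -1) ∧
      ∃ w ∈ B, F w = zmk (e m) 0 ∧ w = zmk (θ • e n) 0 := by
  subst hB
  have hL : ∀ u v : Z, ‖u‖ ≤ 1 → ‖v‖ ≤ 1 → ‖F u - F v‖ ≤ ‖u - v‖ := by
    intro u v hu hv
    have := hne.dist_le_mul u (by simpa using hu) v (by simpa using hv)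
    simpa [dist_eq_norm] using this
  have hF0 := aux_F0 F hbij hL
  have hinj : ∀ u : Z, ‖u‖ ≤ 1 → F u = 0 → u = 0 := by
    intro u hu h
    exact hbij.injOn (by simpa using hu) (by simp) (h.trans hF0.symm)
  have hnz : ∀ m, ‖zmk (e m) 0‖ = 1 := by
    intro m
    have := aux_nsq (zmk (e m) 0)
    rw [aux_zfst, aux_zsnd, aux_norm_e] at this
    have h0 := norm_nonneg (zmk (e m) 0)
    nlinarith
  have hpre : ∀ m, ∃ w : Z, ‖w‖ ≤ 1 ∧ F w = zmk (e m) 0 ∧ F (-w) = - zmk (e m) 0 := by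
    intro m
    obtain ⟨x, hx, hxy⟩ := hbij.surjOn
      (show zmk (e m) 0 ∈ Metric.closedBall (0 : Z) 1 by simp [hnz])
    obtain ⟨z, hz, hzy⟩ := hbij.surjOn
      (show -zmk (e m) 0 ∈ Metric.closedBall (0 : Z) 1 by simp [hnz])
    rw [mem_closedBall_zero_iff] at hx hz
    refine ⟨x, hx, hxy, ?_⟩
    have hxz := norm_add_le x z
    have hxz' := norm_sub_le x z
    have hu : ‖(1/2 : ℝ) • (x + z)‖ ≤ 1 := by
      rw [norm_smul]; norm_num; linarith
    have i1 := hL _ _ hu hx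
    have i2 := hL _ _ hu hz
    rw [hxy] at i1
    rw [hzy, sub_neg_eq_add] at i2
    have j1 : (1/2 : ℝ) • (x + z) - x = (-(1/2) : ℝ) • (x - z) := by module
    have j2 : (1/2 : ℝ) • (x + z) - z = (1/2 : ℝ) • (x - z) := by module
    have k : F ((1/2 : ℝ) • (x + z)) = 0 := by
      apply aux_A m
      · refine i1.trans ?_
        rw [j1, norm_smul]; norm_num; linarith
      · refine i2.trans ?_
        rw [j2, norm_smul]; norm_num; linarith
    have k2 := hinj _ hu k
    have k3 : x + z = 0 := by
      rcases smul_eq_zero.1 k2 with h | h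
      · norm_num at h
      · exact h
    rw [neg_eq_of_add_eq_zero_right k3, hzy]
  intro m
  obtain ⟨w, hw, hFw, hFw'⟩ := hpre m
  obtain ⟨v, hv, hFv, hFv'⟩ := hpre (m + 1)
  have hmk : ∀ θ : ℝ, |θ| = 1 → ‖zmk (e m) 0 + θ • zmk (e (m+1)) 0‖ = 2 := by
    intro θ hθ
    have h := aux_nsq (zmk (e m) 0 + θ • zmk (e (m+1)) 0)
    rw [WithLp.add_fst, WithLp.add_snd, WithLp.smul_fst, WithLp.smul_snd, aux_zfst, aux_zfst,
      aux_zsnd, aux_zsnd, aux_dec, aux_e_apply] at h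
    simp [hθ, aux_norm_e] at h
    have h0 := norm_nonneg (zmk (e m) 0 + θ • zmk (e (m+1)) 0)
    nlinarith
  have d1 : 2 ≤ ‖w - v‖ := by
    have := hL w v hw hv
    rw [hFw, hFv] at this
    have h2 := hmk (-1) (by simp)
    rw [neg_one_smul, ← sub_eq_add_neg] at h2
    linarith
  have d2 : 2 ≤ ‖w + v‖ := by
    have := hL w (-v) hw (by simpa using hv)
    rw [hFw, hFv', sub_neg_eq_add, sub_neg_eq_add] at this
    have h2 := hmk 1 (by simp)
    rw [one_smul] at h2
    linarith
  obtain ⟨hn, hs⟩ := aux_C w v hw hv d1 d2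
  have hext : ∀ p : Z, ‖p‖ ≤ 1 → ‖p - w‖ ≤ 1 → ‖p + w‖ ≤ 1 → p = 0 := by
    intro p hp h1 h2
    apply hinj p hp
    apply aux_A m
    · rw [← hFw]; exact (hL p w hp hw).trans h1
    · have := hL p (-w) hp (by simpa using hw)
      rw [hFw', sub_neg_eq_add, sub_neg_eq_add] at this
      exact this.trans h2
  have hne0 : ∃ n, w.fst n ≠ 0 := by
    by_contra! hcon
    have : w.fst = 0 := by
      ext j
      exact hcon j
    rw [this, norm_zero] at hn
    norm_num at hn
  obtain ⟨n, hnn⟩ := hne0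
  have hfst : w.fst = w.fst n • e n := by
    ext j
    rw [lp.coeFn_smul, Pi.smul_apply, aux_e_apply]
    by_cases hj : j = n
    · subst hj; simp
    · simp [hj, aux_B w hw hext n j (Ne.symm hj) hnn]
  have habs : |w.fst n| = 1 := by
    rw [hfst, norm_smul, aux_norm_e] at hn
    simpa using hn
  refine ⟨w.fst n, n, eq_or_eq_neg_of_abs_eq habs, w, by simpa using hw, hFw, ?_⟩
  exact aux_zext hfst hs
end

section
/- Let Z = ℓ₁ ⊕₂ ℝ and let F : B_Z → B_Z be a non-expansive bijection of the closed unit ball onto itself. Then there exist an injective map σ : ℕ → ℕ and signs θ : ℕ → {−1, 1} such that, setting g_n = θ(n)·e_{σ(n)}, for every real sequence (a_n) with Σ_{n=1}^∞ |a_n| ≤ 1 one has F(Σ_{n=1}^∞ a_n·g_n, 0) = (Σ_{n=1}^∞ a_n·e_n, 0). -/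
structure Good (F : Z → Z) : Prop where
  inj : ∀ x y, ‖x‖ ≤ 1 → ‖y‖ ≤ 1 → F x = F y → x = y
  map : ∀ x, ‖x‖ ≤ 1 → ‖F x‖ ≤ 1
  surj : ∀ y, ‖y‖ ≤ 1 → ∃ x, ‖x‖ ≤ 1 ∧ F x = y
  lip : ∀ x y, ‖x‖ ≤ 1 → ‖y‖ ≤ 1 → ‖F x - F y‖ ≤ ‖x - y‖

theorem e_apply (m n : ℕ) : (e m : Ell1) n = if n = m then 1 else 0 := by
  unfold e
  rw [lp.single_apply]
  by_cases h : n = m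
  · subst h; simp
  · simp [h]

theorem add_ap (x y : Ell1) (n : ℕ) : (x + y : Ell1) n = x n + y n := rfl
theorem sub_ap (x y : Ell1) (n : ℕ) : (x - y : Ell1) n = x n - y n := rfl
theorem neg_ap (x : Ell1) (n : ℕ) : (-x : Ell1) n = -(x n) := rfl
theorem smul_ap (c : ℝ) (x : Ell1) (n : ℕ) : (c • x : Ell1) n = c * x n := rfl
theorem zero_ap (n : ℕ) : (0 : Ell1) n = 0 := rfl

theorem ell_hasSum (x : Ell1) : HasSum (fun n => |x n|) ‖x‖ := by
  have := lp.hasSum_norm (p := 1) (by simp) x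
  simpa using this

theorem coord_le (x : Ell1) (n : ℕ) : |x n| ≤ ‖x‖ :=
  le_hasSum (ell_hasSum x) n (fun _ _ => abs_nonneg _)

theorem norm_add_single (y : Ell1) (c : ℝ) (k : ℕ) :
    ‖y + c • e k‖ = ‖y‖ - |y k| + |y k + c| := by
  have h1 := ell_hasSum y
  have h2 := ell_hasSum (y + c • e k)
  have h3 : HasSum (fun n => if n = k then |y k + c| - |y k| else 0) (|y k + c| - |y k|) :=
    hasSum_ite_eq k _
  have h4 := h1.add h3
  have : (fun n => |(y + c • e k : Ell1) n|) =
      fun n => |y n| + if n = k then |y k + c| - |y k| else 0 := by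
    funext n
    simp only [lp.coeFn_add, lp.coeFn_smul, Pi.add_apply, Pi.smul_apply, e_apply, smul_eq_mul]
    split_ifs with h
    · subst h; simp
    · simp
  rw [this] at h2
  rw [h2.unique h4]; ring

theorem norm_single (c : ℝ) (k : ℕ) : ‖c • e k‖ = |c| := by
  have := norm_add_single 0 c k
  simpa using this

theorem norm_pair (a b : ℝ) {i j : ℕ} (h : i ≠ j) : ‖a • e i + b • e j‖ = |a| + |b| := by
  rw [norm_add_single, norm_single]
  simp [e_apply, h.symm]

theorem three_le (x : Ell1) {i j k : ℕ} (hij : i ≠ j) (hik : i ≠ k) (hjk : j ≠ k) :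
    |x i| + |x j| + |x k| ≤ ‖x‖ := by
  have := sum_le_hasSum {i, j, k} (fun _ _ => abs_nonneg _) (ell_hasSum x)
  rw [Finset.sum_insert (by simp [hij, hik]), Finset.sum_pair hjk] at this
  linarith

theorem between_coord (v y1 y2 : Ell1) (h : ‖v - y1‖ + ‖v - y2‖ ≤ ‖y1 - y2‖) (n : ℕ) :
    |v n - y1 n| + |v n - y2 n| ≤ |y1 n - y2 n| := by
  have h1 := ((ell_hasSum (v - y1)).add (ell_hasSum (v - y2))).sub (ell_hasSum (y1 - y2))
  have := le_hasSum h1 n (fun m _ => by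
    simp only [lp.coeFn_sub, Pi.sub_apply]
    have := abs_sub_le (y1 m) (v m) (y2 m)
    rw [abs_sub_comm (y1 m) (v m)] at this
    linarith)
  simp only [lp.coeFn_sub, Pi.sub_apply] at this
  linarith

theorem zmk_sub (x y : Ell1) (s t : ℝ) : zmk x s - zmk y t = zmk (x - y) (s - t) := rfl
theorem zmk_add (x y : Ell1) (s t : ℝ) : zmk x s + zmk y t = zmk (x + y) (s + t) := rfl
theorem zmk_smul (x : Ell1) (s c : ℝ) : c • zmk x s = zmk (c • x) (c * s) := rfl
theorem zmk_neg (x : Ell1) (s : ℝ) : - zmk x s = zmk (-x) (-s) := rfl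
theorem zmk_zero : zmk 0 0 = 0 := rfl
theorem zmk_eta (p : Z) : zmk p.fst p.snd = p := rfl

theorem zmk_norm_sq (x : Ell1) (t : ℝ) : ‖zmk x t‖ ^ 2 = ‖x‖ ^ 2 + t ^ 2 := by
  rw [WithLp.prod_norm_sq_eq_of_L2]
  simp [zmk]

theorem zmk_norm (x : Ell1) : ‖zmk x 0‖ = ‖x‖ := by
  have := zmk_norm_sq x 0
  have h1 := norm_nonneg (zmk x 0)
  have h2 := norm_nonneg x
  nlinarith

theorem zmk_inj {x y : Ell1} (h : zmk x 0 = zmk y 0) : x = y := by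
  have : (zmk x 0).fst = (zmk y 0).fst := by rw [h]
  exact this

theorem fst_norm_le (p : Z) : ‖p.fst‖ ≤ ‖p‖ := by
  have := zmk_norm_sq p.fst p.snd
  rw [zmk_eta] at this
  have h1 := norm_nonneg p
  nlinarith [sq_nonneg p.snd, norm_nonneg p.fst]

theorem between (p : Z) (y1 y2 : Ell1) (α β : ℝ) (h1 : ‖p - zmk y1 0‖ ≤ α)
    (h2 : ‖p - zmk y2 0‖ ≤ β) (h : α + β ≤ ‖y1 - y2‖) :
    ∃ v, p = zmk v 0 ∧ ‖v - y1‖ = α ∧ ‖v - y2‖ = β ∧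
      ∀ n, |v n - y1 n| + |v n - y2 n| ≤ |y1 n - y2 n| := by
  obtain ⟨v, t, rfl⟩ : ∃ v t, p = zmk v t := ⟨p.fst, p.snd, rfl⟩
  rw [zmk_sub] at h1 h2
  have q1 := zmk_norm_sq (v - y1) (t - 0)
  have q2 := zmk_norm_sq (v - y2) (t - 0)
  have n1 := norm_nonneg (zmk (v - y1) (t - 0))
  have n2 := norm_nonneg (zmk (v - y2) (t - 0))
  have m1 := norm_nonneg (v - y1)
  have m2 := norm_nonneg (v - y2)
  have tri : ‖y1 - y2‖ ≤ ‖v - y1‖ + ‖v - y2‖ := by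
    have := norm_sub_le (v - y2) (v - y1)
    have e1 : v - y2 - (v - y1) = y1 - y2 := by abel
    rw [e1] at this; linarith
  have l1 : ‖v - y1‖ ≤ α := le_trans (by nlinarith [sq_nonneg (t - 0)]) h1
  have l2 : ‖v - y2‖ ≤ β := le_trans (by nlinarith [sq_nonneg (t - 0)]) h2
  have r1 : ‖v - y1‖ = α := by linarith
  have r2 : ‖v - y2‖ = β := by linarith
  have ht : t = 0 := by
    have : (t - 0) ^ 2 ≤ 0 := by nlinarith
    have := pow_eq_zero_iff (two_ne_zero) |>.1 (le_antisymm this (sq_nonneg _))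
    linarith
  subst ht
  exact ⟨v, rfl, r1, r2, between_coord v y1 y2 (by linarith)⟩

theorem F_zero {F : Z → Z} (hF : Good F) : F 0 = 0 := by
  by_contra h
  have hc : 0 < ‖F 0‖ := norm_pos_iff.2 h
  obtain ⟨x, hx, hy⟩ := hF.surj (-(‖F 0‖⁻¹ • F 0)) (by
    rw [norm_neg, norm_smul, norm_inv, norm_norm, inv_mul_cancel₀ hc.ne'])
  have := hF.lip x 0 hx (by simp)
  rw [hy, sub_zero] at this
  have e1 : -(‖F 0‖⁻¹ • F 0) - F 0 = -((‖F 0‖⁻¹ + 1) • F 0) := by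
    rw [add_smul, one_smul]; abel
  rw [e1, norm_neg, norm_smul, Real.norm_of_nonneg (by positivity), add_mul,
    inv_mul_cancel₀ hc.ne'] at this
  linarith

theorem F_norm {F : Z → Z} (hF : Good F) (x : Z) (hx : ‖x‖ ≤ 1) : ‖F x‖ ≤ ‖x‖ := by
  have := hF.lip x 0 hx (by simp)
  simpa [F_zero hF] using this

theorem abs_s {s : ℝ} (hs : s = 1 ∨ s = -1) : |s| = 1 := by
  rcases hs with rfl | rfl <;> simp

/-- extreme point property 1 -/
theorem ext1 {s : ℝ} (hs : s = 1 ∨ s = -1) (i : ℕ) (p : Z) (a : ℝ)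
    (h1 : ‖p‖ ≤ a) (h2 : ‖p - zmk (s • e i) 0‖ ≤ 1 - a) : p = zmk ((a * s) • e i) 0 := by
  obtain ⟨v, rfl, n1, n2, hv⟩ := between p 0 (s • e i) a (1 - a) (by simpa [zmk_zero] using h1) h2
    (by rw [zero_sub, norm_neg, norm_single, abs_s hs]; linarith)
  have hi : ∀ n, n ≠ i → v n = 0 := by
    intro n hn
    have := hv n
    simp [e_apply, hn] at this
    exact this
  have hve : v = (v i) • e i := by
    ext n
    by_cases hn : n = i
    · subst hn; simp [e_apply]
    · simp [e_apply, hn, hi n hn]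
  rw [sub_zero, hve, norm_single] at n1
  have := hv i
  simp [e_apply, abs_s hs] at this
  have : v i = a * s := by
    rcases hs with rfl | rfl
    · rcases abs_cases (v i) with h | h <;> rcases abs_cases (v i - 1) with h' | h' <;> linarith
    · rcases abs_cases (v i) with h | h <;> rcases abs_cases (v i - -1) with h' | h' <;> linarith
  rw [hve, this]

theorem ext2 {s : ℝ} (hs : s = 1 ∨ s = -1) (i : ℕ) (p : Z)
    (h1 : ‖p - zmk (s • e i) 0‖ ≤ 1) (h2 : ‖p - zmk (-(s • e i)) 0‖ ≤ 1) : p = 0 := by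
  obtain ⟨v, rfl, n1, n2, hv⟩ := between p (s • e i) (-(s • e i)) 1 1 h1 h2
    (by rw [show s • e i - -(s • e i) = (2 * s) • e i by module, norm_single, abs_mul, abs_s hs]; norm_num)
  have hi : ∀ n, n ≠ i → v n = 0 := by
    intro n hn
    have := hv n
    simp only [neg_ap, smul_ap, e_apply, hn, if_false, mul_zero, neg_zero, sub_zero, abs_zero] at this
    have h0 := abs_nonneg (v n)
    exact abs_eq_zero.1 (by linarith)
  have hve : v = (v i) • e i := by
    ext n
    by_cases hn : n = i
    · subst hn; simp [e_apply]
    · simp [e_apply, hn, hi n hn]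
  have k1 : |v i - s| = 1 := by
    rw [← n1, ← norm_single (v i - s) i, sub_smul, ← hve]
  have k2 : |v i + s| = 1 := by
    rw [← n2, ← norm_single (v i + s) i, add_smul, ← hve, sub_neg_eq_add]
  have : v i = 0 := by
    rcases hs with rfl | rfl
    · rcases abs_cases (v i - 1) with h | h <;> rcases abs_cases (v i + 1) with h' | h' <;> linarith
    · rcases abs_cases (v i - -1) with h | h <;> rcases abs_cases (v i + -1) with h' | h' <;> linarith
  rw [hve, this, zero_smul, zmk_zero]

theorem exists_g {F : Z → Z} (hF : Good F) (i : ℕ) :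
    ∃ g : Z, ‖g‖ = 1 ∧ (∀ a : ℝ, |a| ≤ 1 → F (a • g) = zmk (a • e i) 0) ∧
      ∀ d, ‖g + d‖ ≤ 1 → ‖g - d‖ ≤ 1 → d = 0 := by
  have key : ∀ s : ℝ, (s = 1 ∨ s = -1) → ∃ g : Z, ‖g‖ = 1 ∧ F g = zmk (s • e i) 0 ∧
      ∀ p : Z, ∀ a : ℝ, ‖p‖ ≤ a → ‖p - g‖ ≤ 1 - a → F p = zmk ((a * s) • e i) 0 := by
    intro s hs
    have hn : ‖zmk (s • e i) 0‖ = 1 := by rw [zmk_norm, norm_single, abs_s hs]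
    obtain ⟨g, hg, hg'⟩ := hF.surj _ hn.le
    have hg1 : ‖g‖ = 1 := le_antisymm hg (by rw [← hn, ← hg']; exact F_norm hF g hg)
    refine ⟨g, hg1, hg', fun p a h1 h2 => ?_⟩
    have hp : ‖p‖ ≤ 1 := by linarith [norm_nonneg (p - g)]
    apply ext1 hs i (F p) a
    · exact (F_norm hF p hp).trans h1
    · rw [← hg']; exact (hF.lip p g hp hg).trans h2
  obtain ⟨g, hg1, hgF, hga⟩ := key 1 (Or.inl rfl)
  obtain ⟨z, hz1, hzF, hza⟩ := key (-1) (Or.inr rfl)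
  have hzg : z = -g := by
    have hm : ‖(1 / 2 : ℝ) • (g + z)‖ ≤ 1 := by
      rw [norm_smul]
      have := norm_add_le g z
      norm_num; linarith
    have e1 : (1 / 2 : ℝ) • (g + z) - g = (1 / 2 : ℝ) • (z - g) := by module
    have e2 : (1 / 2 : ℝ) • (g + z) - z = (1 / 2 : ℝ) • (g - z) := by module
    have b1 : ‖(1 / 2 : ℝ) • (g + z) - g‖ ≤ 1 := by
      rw [e1, norm_smul]; have := norm_sub_le z g; norm_num; linarith
    have b2 : ‖(1 / 2 : ℝ) • (g + z) - z‖ ≤ 1 := by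
      rw [e2, norm_smul]; have := norm_sub_le g z; norm_num; linarith
    have := ext2 (Or.inl rfl) i (F ((1 / 2 : ℝ) • (g + z)))
      (by rw [← hgF]; exact (hF.lip _ _ hm hg1.le).trans b1)
      (by rw [show -((1 : ℝ) • e i) = (-1 : ℝ) • e i by module, ← hzF]
          exact (hF.lip _ _ hm hz1.le).trans b2)
    rw [← F_zero hF] at this
    have := hF.inj _ _ hm (by simp) this
    have h3 : g + z = 0 := by
      rcases smul_eq_zero.1 this with h | h
      · norm_num at h
      · exact h
    exact (neg_eq_of_add_eq_zero_right h3).symm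
  have hpos : ∀ w : Z, ‖w‖ = 1 → ∀ a : ℝ, 0 ≤ a → a ≤ 1 → ‖a • w‖ ≤ a ∧ ‖a • w - w‖ ≤ 1 - a := by
    intro w hw a h0 h1
    constructor
    · rw [norm_smul, hw, Real.norm_of_nonneg h0, mul_one]
    · rw [show a • w - w = -((1 - a) • w) by module, norm_neg, norm_smul, hw,
        Real.norm_of_nonneg (by linarith), mul_one]
  refine ⟨g, hg1, ?_, ?_⟩
  · intro a ha
    rcases le_total 0 a with h | h
    · rw [abs_of_nonneg h] at ha
      obtain ⟨h1, h2⟩ := hpos g hg1 a h ha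
      rw [hga _ a h1 h2, mul_one]
    · rw [abs_of_nonpos h] at ha
      obtain ⟨h1, h2⟩ := hpos z hz1 (-a) (by linarith) ha
      have := hza _ _ h1 h2
      rw [hzg] at this
      simpa using this
  · intro d h1 h2
    have e1 : ‖(1 / 2 : ℝ) • (g + d)‖ ≤ 1 / 2 := by rw [norm_smul]; norm_num; linarith
    have e2 : ‖(1 / 2 : ℝ) • (g + d) - g‖ ≤ 1 - 1 / 2 := by
      rw [show (1 / 2 : ℝ) • (g + d) - g = -((1 / 2 : ℝ) • (g - d)) by module, norm_neg, norm_smul]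
      norm_num; linarith
    have r1 := hga _ _ e1 e2
    obtain ⟨h3, h4⟩ := hpos g hg1 (1 / 2) (by norm_num) (by norm_num)
    have r2 := hga _ _ h3 h4
    have := hF.inj _ _ (by linarith) (by linarith) (r1.trans r2.symm)
    rw [smul_add] at this
    have := add_eq_left.1 this
    rcases smul_eq_zero.1 this with h | h
    · norm_num at h
    · exact h

theorem ext_form (x : Ell1) (hx : ‖x‖ = 1)
    (h : ∀ d : Ell1, ‖x + d‖ ≤ 1 → ‖x - d‖ ≤ 1 → d = 0) :
    ∃ j : ℕ, ∃ s : ℝ, (s = 1 ∨ s = -1) ∧ x = s • e j := by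
  obtain ⟨j, hj⟩ : ∃ j, x j ≠ 0 := by
    by_contra hc
    push Not at hc
    have : x = 0 := by ext n; simpa using hc n
    rw [this] at hx; simp at hx
  obtain ⟨R, hR⟩ : ∃ R, R = x + (-(x j)) • e j := ⟨_, rfl⟩
  have hRn : ‖R‖ = 1 - |x j| := by rw [hR, norm_add_single, hx]; simp
  have hxR : x = R + (x j) • e j := by rw [hR]; module
  have h0 : 0 ≤ ‖R‖ := norm_nonneg R
  have ha : 0 < |x j| := abs_pos.2 hj
  have := h (|x j| • R - (‖R‖ * x j) • e j) (by
      rw [show x + (|x j| • R - (‖R‖ * x j) • e j) = (1 + |x j|) • R + ((1 - ‖R‖) * x j) • e j by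
        nth_rewrite 1 [hxR]; module]
      refine (norm_add_le _ _).trans ?_
      rw [norm_smul, norm_single, abs_mul, Real.norm_of_nonneg (by linarith),
        abs_of_nonneg (by linarith : 0 ≤ 1 - ‖R‖)]
      nlinarith) (by
      rw [show x - (|x j| • R - (‖R‖ * x j) • e j) = (1 - |x j|) • R + ((1 + ‖R‖) * x j) • e j by
        nth_rewrite 1 [hxR]; module]
      refine (norm_add_le _ _).trans ?_
      rw [norm_smul, norm_single, abs_mul, Real.norm_of_nonneg (by linarith),
        abs_of_nonneg (by linarith : 0 ≤ 1 + ‖R‖)]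
      nlinarith)
  have hR0 : ∀ n, n ≠ j → x n = 0 := by
    intro n hn
    have h1 : (|x j| • R - (‖R‖ * x j) • e j : Ell1) n = 0 := by rw [this]; rfl
    rw [hR] at h1
    simp only [sub_ap, add_ap, smul_ap, e_apply, hn, if_false, mul_zero, add_zero, sub_zero] at h1
    rcases mul_eq_zero.1 h1 with h2 | h2
    · exact absurd h2 ha.ne'
    · exact h2
  have hxe : x = (x j) • e j := by
    ext n
    by_cases hn : n = j
    · subst hn; simp [e_apply]
    · simp [e_apply, hn, hR0 n hn]
  refine ⟨j, x j, ?_, hxe⟩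
  rw [hxe, norm_single] at hx
  exact eq_or_eq_neg_of_abs_eq hx

theorem two_le {F : Z → Z} (hF : Good F) {g1 g2 : Z} {i j : ℕ} (hij : i ≠ j)
    (n1 : ‖g1‖ = 1) (n2 : ‖g2‖ = 1) (a b : ℝ) (ha : a = 1 ∨ a = -1) (hb : b = 1 ∨ b = -1)
    (h1 : ∀ a : ℝ, |a| ≤ 1 → F (a • g1) = zmk (a • e i) 0)
    (h2 : ∀ a : ℝ, |a| ≤ 1 → F (a • g2) = zmk (a • e j) 0) : 2 ≤ ‖a • g1 + b • g2‖ := by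
  have := hF.lip (a • g1) ((-b) • g2) (by rw [norm_smul, n1, Real.norm_eq_abs, abs_s ha]; norm_num)
    (by rw [norm_smul, n2, Real.norm_eq_abs, abs_neg, abs_s hb]; norm_num)
  rw [h1 _ (abs_s ha).le, h2 _ (by rw [abs_neg, abs_s hb]), zmk_sub, sub_zero, zmk_norm,
    show a • e i - (-b) • e j = a • e i + b • e j by module,
    show a • g1 - (-b) • g2 = a • g1 + b • g2 by module, norm_pair _ _ hij, abs_s ha, abs_s hb] at this
  linarith

theorem g_form {F : Z → Z} (hF : Good F) {g1 g2 : Z} {i j : ℕ} (hij : i ≠ j)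
    (n1 : ‖g1‖ = 1) (n2 : ‖g2‖ = 1)
    (h1 : ∀ a : ℝ, |a| ≤ 1 → F (a • g1) = zmk (a • e i) 0)
    (h2 : ∀ a : ℝ, |a| ≤ 1 → F (a • g2) = zmk (a • e j) 0)
    (hd : ∀ d, ‖g1 + d‖ ≤ 1 → ‖g1 - d‖ ≤ 1 → d = 0) :
    ∃ k : ℕ, ∃ s : ℝ, (s = 1 ∨ s = -1) ∧ g1 = zmk (s • e k) 0 := by
  have p1 := two_le hF hij n1 n2 1 1 (Or.inl rfl) (Or.inl rfl) h1 h2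
  have p2 := two_le hF hij n1 n2 1 (-1) (Or.inl rfl) (Or.inr rfl) h1 h2
  obtain ⟨x, t, rfl⟩ : ∃ v t, g1 = zmk v t := ⟨g1.fst, g1.snd, rfl⟩
  obtain ⟨y, u, rfl⟩ : ∃ v t, g2 = zmk v t := ⟨g2.fst, g2.snd, rfl⟩
  rw [zmk_smul, zmk_smul, zmk_add] at p1 p2
  simp only [one_smul, one_mul, neg_smul, neg_mul] at p1 p2
  have q1 := zmk_norm_sq (x + y) (t + u)
  have q2 := zmk_norm_sq (x + -y) (t + -u)
  have r1 := zmk_norm_sq x t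
  have r2 := zmk_norm_sq y u
  rw [n1] at r1
  rw [n2] at r2
  have t1 := norm_add_le x y
  have t2 := norm_add_le x (-y)
  rw [norm_neg] at t2
  have m1 := norm_nonneg (x + y)
  have m2 := norm_nonneg (x + -y)
  have mx := norm_nonneg x
  have my := norm_nonneg y
  have s1 : 4 ≤ (‖x‖ + ‖y‖) ^ 2 + (t + u) ^ 2 := by nlinarith
  have s2 : 4 ≤ (‖x‖ + ‖y‖) ^ 2 + (t - u) ^ 2 := by nlinarith
  have z1 : (t - u) ^ 2 ≤ 0 := by nlinarith [sq_nonneg (‖x‖ - ‖y‖)]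
  have z2 : (t + u) ^ 2 ≤ 0 := by nlinarith [sq_nonneg (‖x‖ - ‖y‖)]
  have w1 := pow_eq_zero_iff (two_ne_zero) |>.1 (le_antisymm z1 (sq_nonneg _))
  have w2 := pow_eq_zero_iff (two_ne_zero) |>.1 (le_antisymm z2 (sq_nonneg _))
  have ht : t = 0 := by linarith
  subst ht
  rw [zmk_norm] at n1
  obtain ⟨k, s, hs, hx⟩ := ext_form x n1 (fun d a b => by
    have := hd (zmk d 0) (by rw [zmk_add, add_zero, zmk_norm]; exact a)
      (by rw [zmk_sub, sub_zero, zmk_norm]; exact b)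
    rw [← zmk_zero] at this
    exact zmk_inj this)
  exact ⟨k, s, hs, by rw [hx]⟩

theorem pair_i (a b : ℝ) {i j : ℕ} (h : i ≠ j) : (a • e i + b • e j : Ell1) i = a := by
  simp only [add_ap, smul_ap, e_apply, h, if_false, if_true]; ring

theorem pair_j (a b : ℝ) {i j : ℕ} (h : i ≠ j) : (a • e i + b • e j : Ell1) j = b := by
  simp only [add_ap, smul_ap, e_apply, h.symm, if_false, if_true]; ring

theorem pair_n (a b : ℝ) {i j n : ℕ} (hi : n ≠ i) (hj : n ≠ j) :
    (a • e i + b • e j : Ell1) n = 0 := by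
  simp only [add_ap, smul_ap, e_apply, hi, hj, if_false]; ring

theorem pair_ext (v : Ell1) {i j : ℕ} (h : i ≠ j) (hv : ∀ n, n ≠ i → n ≠ j → v n = 0) :
    v = v i • e i + v j • e j := by
  ext n
  by_cases hi : n = i
  · subst hi; rw [pair_i _ _ h]
  · by_cases hj : n = j
    · subst hj; rw [pair_j _ _ h]
    · rw [pair_n _ _ hi hj, hv n hi hj]

theorem s_sq {s : ℝ} (hs : s = 1 ∨ s = -1) : s * s = 1 := by
  rcases hs with rfl | rfl <;> norm_num

theorem factA {F : Z → Z} (hF : Good F) {g1 g2 : Z} {i j : ℕ} (hij : i ≠ j) {s1 s2 : ℝ}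
    (hs1 : s1 = 1 ∨ s1 = -1) (hs2 : s2 = 1 ∨ s2 = -1)
    (n1 : ‖g1‖ = 1) (n2 : ‖g2‖ = 1)
    (h1 : ∀ a : ℝ, |a| ≤ 1 → F (a • g1) = zmk ((a * s1) • e i) 0)
    (h2 : ∀ a : ℝ, |a| ≤ 1 → F (a • g2) = zmk ((a * s2) • e j) 0)
    (α β : ℝ) (hα : 0 ≤ α) (hβ : 0 ≤ β) (hαβ : α + β ≤ 1) :
    ∃ d, 0 ≤ d ∧ d ≤ α ∧ d ≤ β ∧
      F (α • g1 + β • g2) = zmk (((α - d) * s1) • e i + ((β - d) * s2) • e j) 0 := by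
  have aα : |α| ≤ 1 := by rw [abs_of_nonneg hα]; linarith
  have aβ : |β| ≤ 1 := by rw [abs_of_nonneg hβ]; linarith
  have ng1 : ∀ a : ℝ, ‖a • g1‖ = |a| := fun a => by rw [norm_smul, n1, mul_one, Real.norm_eq_abs]
  have ng2 : ∀ a : ℝ, ‖a • g2‖ = |a| := fun a => by rw [norm_smul, n2, mul_one, Real.norm_eq_abs]
  have nu : ‖α • g1 + β • g2‖ ≤ 1 := by
    refine (norm_add_le _ _).trans ?_
    rw [ng1, ng2, abs_of_nonneg hα, abs_of_nonneg hβ]; exact hαβ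
  obtain ⟨v, hv, m1, -, c1⟩ := between (F (α • g1 + β • g2)) ((α * s1) • e i) ((1 * s2) • e j)
    β (α + (1 - β))
    (by
      rw [← h1 α aα]
      refine (hF.lip _ _ nu (by rw [ng1]; exact aα)).trans ?_
      rw [add_sub_cancel_left, ng2, abs_of_nonneg hβ])
    (by
      rw [← h2 1 (by norm_num)]
      refine (hF.lip _ _ nu (by rw [ng2]; norm_num)).trans ?_
      rw [show α • g1 + β • g2 - (1 : ℝ) • g2 = α • g1 + (-(1 - β)) • g2 by module]
      refine (norm_add_le _ _).trans ?_
      rw [ng1, ng2, abs_neg, abs_of_nonneg hα, abs_of_nonneg (by linarith)])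
    (by
      rw [show (α * s1) • e i - (1 * s2) • e j = (α * s1) • e i + (-s2) • e j by module,
        norm_pair _ _ hij, abs_neg, abs_mul, abs_s hs1, abs_s hs2, abs_of_nonneg hα]
      linarith)
  obtain ⟨v', hv', m2, -, c2⟩ := between (F (α • g1 + β • g2)) ((β * s2) • e j) ((1 * s1) • e i)
    α (β + (1 - α))
    (by
      rw [← h2 β aβ]
      refine (hF.lip _ _ nu (by rw [ng2]; exact aβ)).trans ?_
      rw [add_sub_cancel_right, ng1, abs_of_nonneg hα])
    (by
      rw [← h1 1 (by norm_num)]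
      refine (hF.lip _ _ nu (by rw [ng1]; norm_num)).trans ?_
      rw [show α • g1 + β • g2 - (1 : ℝ) • g1 = β • g2 + (-(1 - α)) • g1 by module]
      refine (norm_add_le _ _).trans ?_
      rw [ng1, ng2, abs_neg, abs_of_nonneg hβ, abs_of_nonneg (by linarith)])
    (by
      rw [show (β * s2) • e j - (1 * s1) • e i = (β * s2) • e j + (-s1) • e i by module,
        norm_pair _ _ hij.symm, abs_neg, abs_mul, abs_s hs1, abs_s hs2, abs_of_nonneg hβ]
      linarith)
  obtain rfl : v = v' := zmk_inj (hv.symm.trans hv')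
  have hz : ∀ n, n ≠ i → n ≠ j → v n = 0 := by
    intro n hi hj
    have := c1 n
    simp only [smul_ap, e_apply, hi, hj, if_false, mul_zero, sub_zero, abs_zero] at this
    exact abs_eq_zero.1 (by linarith [abs_nonneg (v n)])
  have hp := pair_ext v hij hz
  have ci := c1 i
  have cj := c2 j
  simp only [smul_ap, e_apply, hij, hij.symm, if_false, if_true, mul_zero, mul_one, sub_zero] at ci cj
  rw [hp, show v i • e i + v j • e j - (α * s1) • e i = (v i - α * s1) • e i + v j • e j by module,
    norm_pair _ _ hij] at m1
  rw [abs_mul, abs_s hs1, abs_of_nonneg hα, mul_one] at ci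
  rw [abs_mul, abs_s hs2, abs_of_nonneg hβ, mul_one] at cj
  obtain ⟨w1, hw1⟩ : ∃ w, w = v i * s1 := ⟨_, rfl⟩
  obtain ⟨w2, hw2⟩ : ∃ w, w = v j * s2 := ⟨_, rfl⟩
  have vi : v i = w1 * s1 := by rw [hw1, mul_assoc, s_sq hs1, mul_one]
  have vj : v j = w2 * s2 := by rw [hw2, mul_assoc, s_sq hs2, mul_one]
  rw [vi, ← sub_mul, abs_mul, abs_mul, abs_s hs1, mul_one, mul_one] at ci
  rw [vj, ← sub_mul, abs_mul, abs_mul, abs_s hs2, mul_one, mul_one] at cj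
  rw [vi, vj, ← sub_mul, abs_mul, abs_mul, abs_s hs1, abs_s hs2, mul_one, mul_one] at m1
  have b1 : 0 ≤ w1 := by
    rcases abs_cases w1 with h | h <;> rcases abs_cases (w1 - α) with h' | h' <;> linarith
  have b2 : w1 ≤ α := by
    rcases abs_cases w1 with h | h <;> rcases abs_cases (w1 - α) with h' | h' <;> linarith
  have b3 : 0 ≤ w2 := by
    rcases abs_cases w2 with h | h <;> rcases abs_cases (w2 - β) with h' | h' <;> linarith
  have b4 : w2 ≤ β := by
    rcases abs_cases w2 with h | h <;> rcases abs_cases (w2 - β) with h' | h' <;> linarith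
  rw [abs_of_nonpos (by linarith), abs_of_nonneg b3] at m1
  refine ⟨α - w1, by linarith, by linarith, by linarith, ?_⟩
  rw [hv, show α - (α - w1) = w1 by ring, show β - (α - w1) = w2 by linarith, ← vi, ← vj, ← hp]

theorem norm_lower {g1 g2 : Z} (n1 : ‖g1‖ = 1) (n2 : ‖g2‖ = 1) (h : 2 ≤ ‖g1 + g2‖)
    (α β : ℝ) (hα : 0 ≤ α) (hβ : 0 ≤ β) : α + β ≤ ‖α • g1 + β • g2‖ := by
  rcases le_total α β with hh | hh
  · have := norm_sub_le (α • g1 + β • g2) (-((β - α) • g1))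
    rw [show α • g1 + β • g2 - -((β - α) • g1) = β • (g1 + g2) by module, norm_neg, norm_smul,
      norm_smul, n1, Real.norm_of_nonneg hβ, Real.norm_of_nonneg (by linarith)] at this
    nlinarith
  · have := norm_sub_le (α • g1 + β • g2) (-((α - β) • g2))
    rw [show α • g1 + β • g2 - -((α - β) • g2) = α • (g1 + g2) by module, norm_neg, norm_smul,
      norm_smul, n2, Real.norm_of_nonneg hα, Real.norm_of_nonneg (by linarith)] at this
    nlinarith

theorem norm_upper {g1 g2 : Z} (n1 : ‖g1‖ = 1) (n2 : ‖g2‖ = 1)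
    (α β : ℝ) : ‖α • g1 + β • g2‖ ≤ |α| + |β| := by
  refine (norm_add_le _ _).trans ?_
  rw [norm_smul, norm_smul, n1, n2, Real.norm_eq_abs, Real.norm_eq_abs, mul_one, mul_one]

theorem pair_inj {a b a' b' : ℝ} {i j : ℕ} (hij : i ≠ j) {s1 s2 : ℝ}
    (hs1 : s1 = 1 ∨ s1 = -1) (hs2 : s2 = 1 ∨ s2 = -1)
    (h : zmk ((a * s1) • e i + (b * s2) • e j) 0 = zmk ((a' * s1) • e i + (b' * s2) • e j) 0) :
    a = a' ∧ b = b' := by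
  have h := zmk_inj h
  have hi : ((a * s1) • e i + (b * s2) • e j : Ell1) i =
    ((a' * s1) • e i + (b' * s2) • e j : Ell1) i := by rw [h]
  have hj : ((a * s1) • e i + (b * s2) • e j : Ell1) j =
    ((a' * s1) • e i + (b' * s2) • e j : Ell1) j := by rw [h]
  rw [pair_i _ _ hij, pair_i _ _ hij] at hi
  rw [pair_j _ _ hij, pair_j _ _ hij] at hj
  constructor
  · rcases hs1 with rfl | rfl <;> linarith
  · rcases hs2 with rfl | rfl <;> linarith

theorem lem2_one {F : Z → Z} (hF : Good F) {g1 g2 : Z} {i j : ℕ} (hij : i ≠ j) {s1 s2 : ℝ}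
    (hs1 : s1 = 1 ∨ s1 = -1) (hs2 : s2 = 1 ∨ s2 = -1)
    (n1 : ‖g1‖ = 1) (n2 : ‖g2‖ = 1) (n12 : 2 ≤ ‖g1 + g2‖)
    (h1 : ∀ a : ℝ, |a| ≤ 1 → F (a • g1) = zmk ((a * s1) • e i) 0)
    (h2 : ∀ a : ℝ, |a| ≤ 1 → F (a • g2) = zmk ((a * s2) • e j) 0)
    (α β : ℝ) (hα : 0 ≤ α) (hβ : 0 ≤ β) (hαβ : α + β = 1) :
      F (α • g1 + β • g2) = zmk ((α * s1) • e i + (β * s2) • e j) 0 := by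
  have A := factA hF hij hs1 hs2 n1 n2 h1 h2
  obtain ⟨d0, hd0, hd1, -, hFm⟩ := A (1 / 2) (1 / 2) (by norm_num) (by norm_num) (by norm_num)
  have nm : ‖(1 / 2 : ℝ) • g1 + (1 / 2 : ℝ) • g2‖ ≤ 1 := by
    refine (norm_upper n1 n2 _ _).trans ?_
    norm_num
  obtain ⟨c, hc⟩ : ∃ c, c = 1 / 2 - d0 := ⟨_, rfl⟩
  have hc0 : 0 < c := by
    rcases lt_or_eq_of_le (show 0 ≤ c by linarith) with h | h
    · exact h
    · exfalso
      rw [← hc, ← h] at hFm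
      simp only [zero_mul, zero_smul, add_zero, zmk_zero] at hFm
      have := hF.inj _ 0 nm (by simp) (hFm.trans (F_zero hF).symm)
      have h3 := norm_lower n1 n2 n12 (1 / 2) (1 / 2) (by norm_num) (by norm_num)
      rw [this, norm_zero] at h3
      norm_num at h3
  obtain ⟨y, hy⟩ : ∃ y, y = (α * s1) • e i + (β * s2) • e j := ⟨_, rfl⟩
  have ny : ‖y‖ = 1 := by
    rw [hy, norm_pair _ _ hij, abs_mul, abs_mul, abs_s hs1, abs_s hs2, abs_of_nonneg hα,
      abs_of_nonneg hβ]; linarith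
  rw [← hy]
  obtain ⟨x, hx, hFx⟩ := hF.surj (zmk y 0) (by rw [zmk_norm, ny])
  have nx : ‖x‖ = 1 := le_antisymm hx (by
    rw [← ny, ← zmk_norm, ← hFx]; exact F_norm hF x hx)
  obtain ⟨l, hl⟩ : ∃ l, l = c / 2 := ⟨_, rfl⟩
  have l0 : 0 < l := by linarith
  have l1 : l ≤ 1 / 4 := by linarith
  have nlx : ‖l • x‖ = l := by rw [norm_smul, nx, mul_one, Real.norm_of_nonneg l0.le]
  obtain ⟨v, hv, m1, -, cv⟩ := between (F (l • x)) 0 y l (1 - l)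
    (by rw [zmk_zero, sub_zero]; exact (F_norm hF _ (by linarith)).trans nlx.le)
    (by
      rw [← hFx]
      refine (hF.lip _ _ (by linarith) hx).trans ?_
      rw [show l • x - x = -((1 - l) • x) by module, norm_neg, norm_smul, nx, mul_one,
        Real.norm_of_nonneg (by linarith)])
    (by rw [zero_sub, norm_neg, ny]; linarith)
  have hz : ∀ n, n ≠ i → n ≠ j → v n = 0 := by
    intro n hi hj
    have := cv n
    rw [hy, pair_n _ _ hi hj] at this
    simp only [zero_ap, sub_zero, abs_zero] at this
    exact abs_eq_zero.1 (by linarith [abs_nonneg (v n)])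
  have hp := pair_ext v hij hz
  have ci := cv i
  have cj := cv j
  rw [hy, pair_i _ _ hij, zero_ap, sub_zero, zero_sub, abs_neg, abs_mul, abs_s hs1,
    abs_of_nonneg hα, mul_one] at ci
  rw [hy, pair_j _ _ hij, zero_ap, sub_zero, zero_sub, abs_neg, abs_mul, abs_s hs2,
    abs_of_nonneg hβ, mul_one] at cj
  rw [sub_zero, hp, norm_pair _ _ hij] at m1
  obtain ⟨w1, hw1⟩ : ∃ w, w = v i * s1 := ⟨_, rfl⟩
  obtain ⟨w2, hw2⟩ : ∃ w, w = v j * s2 := ⟨_, rfl⟩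
  have vi : v i = w1 * s1 := by rw [hw1, mul_assoc, s_sq hs1, mul_one]
  have vj : v j = w2 * s2 := by rw [hw2, mul_assoc, s_sq hs2, mul_one]
  rw [vi, ← sub_mul, abs_mul, abs_mul, abs_s hs1, mul_one, mul_one] at ci
  rw [vj, ← sub_mul, abs_mul, abs_mul, abs_s hs2, mul_one, mul_one] at cj
  rw [vi, vj, abs_mul, abs_mul, abs_s hs1, abs_s hs2, mul_one, mul_one] at m1
  have b1 : 0 ≤ w1 := by
    rcases abs_cases w1 with h | h <;> rcases abs_cases (w1 - α) with h' | h' <;> linarith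
  have b3 : 0 ≤ w2 := by
    rcases abs_cases w2 with h | h <;> rcases abs_cases (w2 - β) with h' | h' <;> linarith
  rw [abs_of_nonneg b1, abs_of_nonneg b3] at m1
  obtain ⟨δ, hδ⟩ : ∃ δ, δ = w1 - w2 := ⟨_, rfl⟩
  have dl : |δ| ≤ l := by rw [abs_le]; constructor <;> linarith
  let q : ℝ → Z := fun s => ((s + δ) / 2) • g1 + ((s - δ) / 2) • g2
  let φ : ℝ → ℝ := fun s => s1 * (F (q s)).fst i
  have cf : ∀ a b : Z, |s1 * a.fst i - s1 * b.fst i| ≤ ‖a - b‖ := by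
    intro a b
    rw [← mul_sub, abs_mul, abs_s hs1, one_mul]
    exact (coord_le (a.fst - b.fst) i).trans (fst_norm_le (a - b))
  have hpos : ∀ s, |δ| ≤ s → 0 ≤ (s + δ) / 2 ∧ 0 ≤ (s - δ) / 2 := by
    intro s hs
    have := abs_le.1 hs
    constructor <;> linarith
  have nq : ∀ s, |δ| ≤ s → s ≤ 1 → ‖q s‖ ≤ 1 := by
    intro s h h'
    refine (norm_upper n1 n2 _ _).trans ?_
    rw [abs_of_nonneg (hpos s h).1, abs_of_nonneg (hpos s h).2]; linarith
  have hφA : ∀ s, |δ| ≤ s → s ≤ 1 → ∃ d, 0 ≤ d ∧ d ≤ (s + δ) / 2 ∧ d ≤ (s - δ) / 2 ∧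
      φ s = (s + δ) / 2 - d ∧
      F (q s) = zmk ((((s + δ) / 2 - d) * s1) • e i + (((s - δ) / 2 - d) * s2) • e j) 0 := by
    intro s h h'
    obtain ⟨d, k1, k2, k3, k4⟩ := A ((s + δ) / 2) ((s - δ) / 2) (hpos s h).1 (hpos s h).2 (by linarith)
    refine ⟨d, k1, k2, k3, ?_, k4⟩
    change s1 * (F (q s)).fst i = _
    change F (q s) = _ at k4
    rw [k4]
    change s1 * ((((s + δ) / 2 - d) * s1) • e i + (((s - δ) / 2 - d) * s2) • e j : Ell1) i = _
    rw [pair_i _ _ hij]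
    linear_combination ((s + δ) / 2 - d) * s_sq hs1
  have hcont : ContinuousOn φ (Set.Icc |δ| 1) := by
    have : LipschitzOnWith 1 φ (Set.Icc |δ| 1) := by
      apply LipschitzOnWith.of_dist_le_mul
      intro s hs t ht
      rw [Real.dist_eq, Real.dist_eq, NNReal.coe_one, one_mul]
      refine (cf _ _).trans ((hF.lip _ _ (nq s hs.1 hs.2) (nq t ht.1 ht.2)).trans ?_)
      rw [show q s - q t = ((s - t) / 2) • g1 + ((s - t) / 2) • g2 by simp only [q]; module]
      refine (norm_upper n1 n2 _ _).trans ?_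
      rw [abs_div, abs_two]; linarith
    exact this.continuousOn
  have hd1' : |δ| ≤ 1 := by linarith
  have hlow : φ |δ| ≤ w1 := by
    obtain ⟨d, k1, k2, k3, k4, -⟩ := hφA _ le_rfl hd1'
    rw [k4]
    rcases abs_cases δ with h | h <;> linarith
  have hhigh : w1 ≤ φ 1 := by
    have k1 := cf (F ((1 / 2 : ℝ) • g1 + (1 / 2 : ℝ) • g2)) (F (q 1))
    have k2 := hF.lip _ _ nm (nq 1 hd1' le_rfl)
    have k3 : ‖(1 / 2 : ℝ) • g1 + (1 / 2 : ℝ) • g2 - q 1‖ ≤ |δ| := by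
      rw [show (1 / 2 : ℝ) • g1 + (1 / 2 : ℝ) • g2 - q 1 = (-(δ / 2)) • g1 + (δ / 2) • g2 by
        simp only [q]; module]
      refine (norm_upper n1 n2 _ _).trans ?_
      rw [abs_neg, abs_div, abs_two]; linarith
    have k4 : s1 * (F ((1 / 2 : ℝ) • g1 + (1 / 2 : ℝ) • g2)).fst i = c := by
      rw [hFm]
      change s1 * (((1 / 2 - d0) * s1) • e i + ((1 / 2 - d0) * s2) • e j : Ell1) i = _
      rw [pair_i _ _ hij, ← hc]
      linear_combination c * s_sq hs1
    rw [k4] at k1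
    change |c - φ 1| ≤ _ at k1
    have := (abs_le.1 k1).2
    linarith
  obtain ⟨s, hs, hφs⟩ := intermediate_value_Icc hd1' hcont ⟨hlow, hhigh⟩
  obtain ⟨d, k1, k2, k3, k4, k5⟩ := hφA s hs.1 hs.2
  have hqx : q s = l • x := by
    apply hF.inj _ _ (nq s hs.1 hs.2) (by linarith)
    rw [hv, k5, hp, vi, vj, show (s + δ) / 2 - d = w1 by linarith,
      show (s - δ) / 2 - d = w2 by linarith]
  have hsl : s = l := by
    have u1 := norm_lower n1 n2 n12 _ _ (hpos s hs.1).1 (hpos s hs.1).2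
    have u2 := norm_upper n1 n2 ((s + δ) / 2) ((s - δ) / 2)
    rw [abs_of_nonneg (hpos s hs.1).1, abs_of_nonneg (hpos s hs.1).2] at u2
    change _ ≤ ‖q s‖ at u1
    change ‖q s‖ ≤ _ at u2
    rw [hqx, nlx] at u1 u2
    linarith
  obtain ⟨a', ha'⟩ : ∃ a', a' = ((s + δ) / 2) / l := ⟨_, rfl⟩
  obtain ⟨b', hb'⟩ : ∃ b', b' = ((s - δ) / 2) / l := ⟨_, rfl⟩
  have hxe : x = a' • g1 + b' • g2 := by
    have : x = l⁻¹ • q s := by rw [hqx, smul_smul, inv_mul_cancel₀ l0.ne', one_smul]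
    rw [this, ha', hb']
    simp only [q, smul_add, smul_smul]
    congr 2 <;> ring
  have hab : a' + b' = 1 := by
    rw [ha', hb', ← add_div, hsl]; field_simp; ring
  obtain ⟨d', _, _, _, r4⟩ := A a' b' (by rw [ha']; exact div_nonneg (hpos s hs.1).1 l0.le)
    (by rw [hb']; exact div_nonneg (hpos s hs.1).2 l0.le) hab.le
  rw [← hxe, hFx, hy] at r4
  obtain ⟨r5, r6⟩ := pair_inj hij hs1 hs2 r4
  have : d' = 0 := by linarith
  rw [← hFx, hxe]
  rw [show α = a' by linarith, show β = b' by linarith]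

theorem lem2 {F : Z → Z} (hF : Good F) {g1 g2 : Z} {i j : ℕ} (hij : i ≠ j) {s1 s2 : ℝ}
    (hs1 : s1 = 1 ∨ s1 = -1) (hs2 : s2 = 1 ∨ s2 = -1)
    (n1 : ‖g1‖ = 1) (n2 : ‖g2‖ = 1) (n12 : 2 ≤ ‖g1 + g2‖)
    (h1 : ∀ a : ℝ, |a| ≤ 1 → F (a • g1) = zmk ((a * s1) • e i) 0)
    (h2 : ∀ a : ℝ, |a| ≤ 1 → F (a • g2) = zmk ((a * s2) • e j) 0)
    (α β : ℝ) (hα : 0 ≤ α) (hβ : 0 ≤ β) (hαβ : α + β ≤ 1) :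
      F (α • g1 + β • g2) = zmk ((α * s1) • e i + (β * s2) • e j) 0 := by
  obtain ⟨d, hd, hd1, hd2, hFu⟩ := factA hF hij hs1 hs2 n1 n2 h1 h2 α β hα hβ hαβ
  rcases eq_or_lt_of_le (add_nonneg hα hβ) with h | h
  · have ha : α = 0 := by linarith
    have hb : β = 0 := by linarith
    subst ha; subst hb
    simp [F_zero hF, zmk_zero]
  obtain ⟨s, hs⟩ : ∃ s, s = α + β := ⟨_, rfl⟩
  rw [← hs] at h hαβ
  have hab : α / s + β / s = 1 := by rw [← add_div, ← hs, div_self h.ne']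
  have L := lem2_one hF hij hs1 hs2 n1 n2 n12 h1 h2 (α / s) (β / s) (div_nonneg hα h.le)
    (div_nonneg hβ h.le) hab
  have ga : α ≤ α / s := by rw [le_div_iff₀ h]; nlinarith
  have gb : β ≤ β / s := by rw [le_div_iff₀ h]; nlinarith
  have k := hF.lip ((α / s) • g1 + (β / s) • g2) (α • g1 + β • g2)
    ((norm_upper n1 n2 _ _).trans (by rw [abs_of_nonneg (by linarith), abs_of_nonneg (by linarith)]; linarith))
    ((norm_upper n1 n2 _ _).trans (by rw [abs_of_nonneg (by linarith), abs_of_nonneg (by linarith)]; linarith))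
  rw [show (α / s) • g1 + (β / s) • g2 - (α • g1 + β • g2) = (α / s - α) • g1 + (β / s - β) • g2 by
    module] at k
  have k' := k.trans (norm_upper n1 n2 _ _)
  rw [L, hFu, zmk_sub, sub_zero, zmk_norm,
    show (α / s * s1) • e i + (β / s * s2) • e j - (((α - d) * s1) • e i + ((β - d) * s2) • e j)
      = ((α / s - α + d) * s1) • e i + ((β / s - β + d) * s2) • e j by module,
    norm_pair _ _ hij, abs_mul, abs_mul, abs_s hs1, abs_s hs2,
    abs_of_nonneg (by linarith : 0 ≤ α / s - α + d), abs_of_nonneg (by linarith : 0 ≤ β / s - β + d),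
    abs_of_nonneg (by linarith : 0 ≤ α / s - α), abs_of_nonneg (by linarith : 0 ≤ β / s - β)] at k'
  have : d = 0 := by linarith
  rw [hFu, this, sub_zero, sub_zero]

noncomputable def Tm (g : ℕ → Ell1) (x : Ell1) : Ell1 := ∑' n, x n • g n

theorem Tm_summable {g : ℕ → Ell1} (hg : ∀ n, ‖g n‖ = 1) (x : Ell1) :
    Summable (fun n => x n • g n) := by
  apply Summable.of_norm
  have := (ell_hasSum x).summable
  refine this.congr (fun n => ?_)
  rw [norm_smul, hg, mul_one, Real.norm_eq_abs]

theorem Tm_sub {g : ℕ → Ell1} (hg : ∀ n, ‖g n‖ = 1) (x y : Ell1) :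
    Tm g x - Tm g y = Tm g (x - y) := by
  unfold Tm
  rw [← (Tm_summable hg x).tsum_sub (Tm_summable hg y)]
  congr 1; funext n
  rw [sub_ap, sub_smul]

theorem Tm_single {g : ℕ → Ell1} (c : ℝ) (k : ℕ) : Tm g (c • e k) = c • g k := by
  unfold Tm
  rw [tsum_eq_single k]
  · simp only [smul_ap, e_apply, if_true, mul_one]
  · intro n hn
    simp only [smul_ap, e_apply, hn, if_false, mul_zero, zero_smul]

theorem Tm_norm {g : ℕ → Ell1} (hg : ∀ n, ‖g n‖ = 1) (x : Ell1) : ‖Tm g x‖ ≤ ‖x‖ := by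
  apply tsum_of_norm_bounded (ell_hasSum x)
  intro n
  rw [norm_smul, hg, mul_one, Real.norm_eq_abs]

theorem step_k {F : Z → Z} (hF : Good F) {g : ℕ → Ell1} (hg : ∀ n, ‖g n‖ = 1)
    (h1 : ∀ n, ∀ a : ℝ, |a| ≤ 1 → F (zmk (a • g n) 0) = zmk (a • e n) 0)
    (x : Ell1) (hx : ‖x‖ ≤ 1) (k : ℕ)
    (ih : F (zmk (Tm g (x - x k • e k)) 0) = zmk (x - x k • e k) 0) :
    ∃ v, F (zmk (Tm g x) 0) = zmk v 0 ∧ ‖v - (x - x k • e k)‖ = |x k| ∧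
      ∀ n, n ≠ k → |v n - x n| + |v n| ≤ |x n| := by
  have hk := coord_le x k
  obtain ⟨s, hs, hs'⟩ : ∃ s : ℝ, (s = 1 ∨ s = -1) ∧ |x k - s| = 1 - |x k| := by
    rcases le_total 0 (x k) with h | h
    · refine ⟨1, Or.inl rfl, ?_⟩
      rw [abs_of_nonneg h] at hk ⊢
      rw [abs_of_nonpos (by linarith)]; ring
    · refine ⟨-1, Or.inr rfl, ?_⟩
      rw [abs_of_nonpos h] at hk ⊢
      rw [abs_of_nonneg (by linarith)]; ring
  have nT : ∀ y, ‖y‖ ≤ 1 → ‖zmk (Tm g y) 0‖ ≤ 1 := fun y hy => by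
    rw [zmk_norm]; exact (Tm_norm hg y).trans hy
  have ny : ‖x - x k • e k‖ = ‖x‖ - |x k| := by
    rw [show x - x k • e k = x + (-x k) • e k by module, norm_add_single]; simp
  obtain ⟨v, hv, m1, -, cv⟩ := between (F (zmk (Tm g x) 0)) (x - x k • e k) (s • e k)
    |x k| (‖x‖ - |x k| + |x k - s|)
    (by
      rw [← ih]
      refine (hF.lip _ _ (nT x hx) (nT _ (by rw [ny]; linarith [abs_nonneg (x k)]))).trans ?_
      rw [zmk_sub, sub_zero, zmk_norm, Tm_sub hg]
      refine (Tm_norm hg _).trans ?_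
      rw [show x - (x - x k • e k) = x k • e k by module, norm_single])
    (by
      rw [← h1 k s (abs_s hs).le, ← Tm_single]
      refine (hF.lip _ _ (nT x hx) (nT _ (by rw [norm_single, abs_s hs]))).trans ?_
      rw [zmk_sub, sub_zero, zmk_norm, Tm_sub hg]
      refine (Tm_norm hg _).trans ?_
      rw [show x - s • e k = x + (-s) • e k by module, norm_add_single, ← sub_eq_add_neg])
    (by
      rw [show x - x k • e k - s • e k = x + (-x k - s) • e k by module, norm_add_single,
        show x k + (-x k - s) = -s by ring, abs_neg, abs_s hs, hs']
      linarith)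
  refine ⟨v, hv, m1, fun n hn => ?_⟩
  have := cv n
  simp only [sub_ap, smul_ap, e_apply, hn, if_false, mul_zero, sub_zero] at this
  exact this

theorem fin_case {F : Z → Z} (hF : Good F) {g : ℕ → Ell1} (hg : ∀ n, ‖g n‖ = 1)
    (h1 : ∀ n, ∀ a : ℝ, |a| ≤ 1 → F (zmk (a • g n) 0) = zmk (a • e n) 0) (m : ℕ) :
    ∀ A : Finset ℕ, A.card = m → ∀ x : Ell1, (∀ n, n ∉ A → x n = 0) → ‖x‖ ≤ 1 →
      F (zmk (Tm g x) 0) = zmk x 0 := by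
  induction m using Nat.strong_induction_on with
  | _ m IH =>
  intro A hA x hxA hx
  rcases lt_or_ge 2 A.card with h3 | h3
  · obtain ⟨i, hi, j, hj, k, hk, hij, hik, hjk⟩ := Finset.two_lt_card.1 h3
    have step : ∀ k ∈ A, ∃ v, F (zmk (Tm g x) 0) = zmk v 0 ∧ ‖v - (x - x k • e k)‖ = |x k| ∧
        ∀ n, n ≠ k → |v n - x n| + |v n| ≤ |x n| := by
      intro k hk
      apply step_k hF hg h1 x hx k
      apply IH (A.erase k).card _ (A.erase k) rfl
      · intro n hn
        by_cases hnk : n = k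
        · subst hnk
          simp only [sub_ap, smul_ap, e_apply, if_true]; ring
        · have : n ∉ A := fun h => hn (Finset.mem_erase.2 ⟨hnk, h⟩)
          simp only [sub_ap, smul_ap, e_apply, hnk, if_false, hxA n this]; ring
      · rw [show x - x k • e k = x + (-x k) • e k by module, norm_add_single]
        simp
        linarith [abs_nonneg (x k)]
      · rw [← hA]; exact Finset.card_erase_lt_of_mem hk
    obtain ⟨v, hv, mi, ci⟩ := step i hi
    obtain ⟨v', hv', mj, cj⟩ := step j hj
    obtain rfl := zmk_inj (hv.symm.trans hv')
    obtain ⟨v', hv'', mk, -⟩ := step k hk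
    obtain rfl := zmk_inj (hv.symm.trans hv'')
    have call : ∀ n, |v n - x n| + |v n| ≤ |x n| := by
      intro n
      by_cases h : n = i
      · exact cj n (by rw [h]; exact hij)
      · exact ci n h
    have key : ∀ n, ‖v - (x - x n • e n)‖ = |x n| → ‖v - x‖ ≤ 2 * |(v - x : Ell1) n| := by
      intro n hn
      rw [show v - (x - x n • e n) = (v - x) + x n • e n by module, norm_add_single, sub_ap,
        sub_add_cancel] at hn
      have t := abs_sub_abs_le_abs_sub (x n) (v n)
      rw [abs_sub_comm] at t
      rw [sub_ap]
      linarith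
    have r1 := key i mi
    have r2 := key j mj
    have r3 := key k mk
    have r4 := three_le (v - x) hij hik hjk
    have : ‖v - x‖ = 0 := le_antisymm (by linarith) (norm_nonneg _)
    rw [hv, sub_eq_zero.1 (norm_eq_zero.1 this)]
  · have hcase : A.card = 0 ∨ A.card = 1 ∨ A.card = 2 := by omega
    have single : ∀ k, ‖x k • e k‖ ≤ 1 → F (zmk (Tm g (x k • e k)) 0) = zmk (x k • e k) 0 := by
      intro k hk
      rw [Tm_single]
      exact h1 k _ (by rwa [norm_single] at hk)
    rcases hcase with h | h | h
    · rw [Finset.card_eq_zero] at h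
      have : x = x 0 • e 0 := by
        ext n
        simp [hxA, h, smul_ap]
      rw [this] at hx ⊢
      have h0 : x 0 = 0 := hxA 0 (by simp [h])
      rw [h0, Tm_single]
      exact h1 0 0 (by simp)
    · obtain ⟨k, rfl⟩ := Finset.card_eq_one.1 h
      have : x = x k • e k := by
        ext n
        by_cases hn : n = k
        · subst hn; simp [smul_ap, e_apply]
        · rw [hxA n (by simpa using hn)]; simp only [smul_ap, e_apply, hn, if_false, mul_zero]
      rw [this] at hx
      have := single k hx
      rwa [← ‹x = x k • e k›] at this
    · obtain ⟨i, j, hij, rfl⟩ := Finset.card_eq_two.1 h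
      have hp := pair_ext x hij (fun n hi hj => hxA n (by simp [hi, hj]))
      obtain ⟨a, ha⟩ : ∃ a, a = x i := ⟨_, rfl⟩
      obtain ⟨b, hb⟩ : ∃ b, b = x j := ⟨_, rfl⟩
      rw [← ha, ← hb] at hp
      have sgn : ∀ a : ℝ, ∃ s, (s = 1 ∨ s = -1) ∧ |a| * s = a := by
        intro a
        rcases le_total 0 a with h | h
        · exact ⟨1, Or.inl rfl, by rw [abs_of_nonneg h, mul_one]⟩
        · exact ⟨-1, Or.inr rfl, by rw [abs_of_nonpos h]; ring⟩
      obtain ⟨s1, hs1, e1⟩ := sgn a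
      obtain ⟨s2, hs2, e2⟩ := sgn b
      have hT : Tm g x = a • g i + b • g j := by
        have := Tm_sub hg x (b • e j)
        rw [Tm_single, hp, add_sub_cancel_right, Tm_single, sub_eq_iff_eq_add, ← hp] at this
        exact this
      have hh : ∀ n, ∀ a : ℝ, |a| ≤ 1 → F (a • zmk (g n) 0) = zmk (a • e n) 0 := by
        intro n a ha
        rw [zmk_smul, mul_zero]; exact h1 n a ha
      have nz : ∀ n, ‖zmk (g n) 0‖ = 1 := fun n => by rw [zmk_norm, hg]
      have hs : ∀ n, ∀ s : ℝ, (s = 1 ∨ s = -1) → ∀ a : ℝ, |a| ≤ 1 →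
          F (a • s • zmk (g n) 0) = zmk ((a * s) • e n) 0 := by
        intro n s hs a ha
        rw [smul_smul]
        exact hh n _ (by rw [abs_mul, abs_s hs, mul_one]; exact ha)
      have nn : ‖x‖ = |a| + |b| := by rw [hp, norm_pair _ _ hij]
      have L := lem2 hF hij hs1 hs2
        (g1 := s1 • zmk (g i) 0) (g2 := s2 • zmk (g j) 0)
        (by rw [norm_smul, nz, Real.norm_eq_abs, abs_s hs1, mul_one])
        (by rw [norm_smul, nz, Real.norm_eq_abs, abs_s hs2, mul_one])
        (two_le hF hij (nz i) (nz j) s1 s2 hs1 hs2 (hh i) (hh j))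
        (hs i s1 hs1) (hs j s2 hs2) |a| |b| (abs_nonneg _) (abs_nonneg _) (by rw [← nn]; exact hx)
      rw [smul_smul, smul_smul, e1, e2, zmk_smul, zmk_smul, zmk_add, ← hT, ← hp] at L
      simpa using L

theorem full_case {F : Z → Z} (hF : Good F) {g : ℕ → Ell1} (hg : ∀ n, ‖g n‖ = 1)
    (h1 : ∀ n, ∀ a : ℝ, |a| ≤ 1 → F (zmk (a • g n) 0) = zmk (a • e n) 0)
    (x : Ell1) (hx : ‖x‖ ≤ 1) (hsum : HasSum (fun n => x n • e n) x) :
    F (zmk (Tm g x) 0) = zmk x 0 := by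
  rw [← sub_eq_zero, ← norm_eq_zero]
  refine le_antisymm (le_of_forall_pos_le_add fun ε hε => ?_) (norm_nonneg _)
  rw [HasSum, SummationFilter.unconditional_filter, Metric.tendsto_atTop] at hsum
  obtain ⟨A, hA⟩ := hsum (ε / 2) (by linarith)
  have hA := hA A le_rfl
  obtain ⟨y, hy⟩ : ∃ y, y = ∑ n ∈ A, x n • e n := ⟨_, rfl⟩
  rw [← hy, dist_eq_norm] at hA
  have yap : ∀ n, y n = if n ∈ A then x n else 0 := by
    intro n
    rw [hy, lp.coeFn_sum, Finset.sum_apply]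
    simp only [smul_ap, e_apply, mul_ite, mul_one, mul_zero]
    rw [Finset.sum_ite_eq]
  have nyx : ‖y‖ ≤ ‖x‖ := by
    refine hasSum_le (fun n => ?_) (ell_hasSum y) (ell_hasSum x)
    rw [yap]
    split_ifs
    · exact le_rfl
    · simp
  have hFy := fin_case hF hg h1 _ A rfl y (fun n hn => by rw [yap, if_neg hn]) (nyx.trans hx)
  have k := hF.lip (zmk (Tm g x) 0) (zmk (Tm g y) 0)
    (by rw [zmk_norm]; exact (Tm_norm hg x).trans hx)
    (by rw [zmk_norm]; exact (Tm_norm hg y).trans (nyx.trans hx))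
  rw [zmk_sub (Tm g x), sub_zero, zmk_norm, Tm_sub hg, hFy] at k
  have k2 := k.trans (Tm_norm hg _)
  rw [norm_sub_rev] at hA
  have := norm_add_le (F (zmk (Tm g x) 0) - zmk y 0) (zmk y 0 - zmk x 0)
  rw [sub_add_sub_cancel, zmk_sub y, sub_zero, zmk_norm, norm_sub_rev y x] at this
  linarith

/-- If F is a non-expansive bijection of the closed unit ball of Z = ℓ₁ ⊕₂ ℝ
onto itself, then there exist an injective σ : ℕ → ℕ and signs θ : ℕ → {-1, 1}
such that, with g_n = θ(n)·e_{σ(n)}, for every real sequence (a_n) with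
Σ|a_n| ≤ 1 one has F(Σ a_n·g_n, 0) = (Σ a_n·e_n, 0). -/
theorem image_of_ell1_combinations_ell1_sum2_real
    (B : Set Z) (hB : B = Metric.closedBall (0 : Z) 1)
    (F : Z → Z) (hbij : Set.BijOn F B B) (hne : LipschitzOnWith 1 F B) :
    ∃ (σ : ℕ → ℕ) (θ : ℕ → ℝ), Function.Injective σ ∧
      (∀ n, θ n = 1 ∨ θ n = -1) ∧
      ∀ a : ℕ → ℝ, Summable (fun n => |a n|) → (∑' n, |a n|) ≤ 1 →
        F (zmk (∑' n, a n • (θ n • e (σ n))) 0) = zmk (∑' n, a n • e n) 0 := by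
  have hmem : ∀ x : Z, x ∈ B ↔ ‖x‖ ≤ 1 := fun x => by rw [hB, mem_closedBall_zero_iff]
  have hF : Good F := {
    inj := fun x y hx hy h => hbij.injOn ((hmem x).2 hx) ((hmem y).2 hy) h
    map := fun x hx => (hmem _).1 (hbij.mapsTo ((hmem x).2 hx))
    surj := fun y hy => by
      obtain ⟨x, hx, h⟩ := hbij.surjOn ((hmem y).2 hy)
      exact ⟨x, (hmem x).1 hx, h⟩
    lip := fun x y hx hy => by
      have := hne.dist_le_mul x ((hmem x).2 hx) y ((hmem y).2 hy)
      rwa [NNReal.coe_one, one_mul, dist_eq_norm, dist_eq_norm] at this }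
  choose G hG1 hGF hGd using fun i => exists_g hF i
  have hform : ∀ n, ∃ k : ℕ, ∃ s : ℝ, (s = 1 ∨ s = -1) ∧ G n = zmk (s • e k) 0 := fun n =>
    g_form hF (Nat.succ_ne_self n).symm (hG1 n) (hG1 (n + 1)) (hGF n) (hGF (n + 1)) (hGd n)
  choose σ θ hθ hGe using hform
  refine ⟨σ, θ, ?_, hθ, ?_⟩
  · intro n m hnm
    by_contra hne'
    have key := fun b hb => two_le hF hne' (hG1 n) (hG1 m) 1 b (Or.inl rfl) hb (hGF n) (hGF m)
    have k1 := key 1 (Or.inl rfl)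
    have k2 := key (-1) (Or.inr rfl)
    rw [hGe n, hGe m, hnm, zmk_smul, zmk_smul, zmk_add, smul_smul, smul_smul, ← add_smul] at k1 k2
    simp only [mul_zero, add_zero, zmk_norm, norm_single] at k1 k2
    rcases hθ n with h | h <;> rcases hθ m with h' | h' <;> rw [h, h'] at k1 k2 <;>
      (revert k1 k2; norm_num)
  · intro a ha hsum
    have hmemlp : Memℓp a 1 := by
      apply memℓp_gen
      simpa using ha
    obtain ⟨x, hx⟩ : ∃ x : Ell1, ∀ n, x n = a n := ⟨⟨a, hmemlp⟩, fun n => rfl⟩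
    have nx : ‖x‖ ≤ 1 := by
      rw [← (ell_hasSum x).tsum_eq]; simpa only [hx] using hsum
    have hs : HasSum (fun n => x n • e n) x := by
      have := lp.hasSum_single (p := 1) (by simp) x
      convert this using 2 with n
      ext m
      by_cases hm : m = n
      · subst hm; simp [smul_ap, e_apply]
      · simp only [smul_ap, e_apply, hm, if_false, mul_zero]
        rw [lp.single_apply]; simp [hm]
    have := full_case hF (g := fun n => θ n • e (σ n))
      (fun n => by rw [norm_single, abs_s (hθ n)])
      (fun n c hc => by
        have := hGF n c hc
        rwa [hGe n, zmk_smul, mul_zero] at this) x nx hs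
    simp only [← hx]
    rw [hs.tsum_eq]
    exact this
end

section
/- Let Z = ℓ₁ ⊕₂ ℝ, let h : Z → ℝ be the projection onto the ℝ-coordinate, let L₀ = { z ∈ B_Z : h(z) = 0 }, and let F : B_Z → B_Z be a non-expansive bijection of the closed unit ball onto itself. Then F⁻¹(L₀) = L₀ (equivalently, F(L₀) = L₀). -/
/-- The projection of Z = ℓ₁ ⊕₂ ℝ onto the real coordinate. -/
noncomputable def h (z : Z) : ℝ := ((WithLp.equiv 2 (Ell1 × ℝ)) z).2


namespace PlB

lemma l1_hasSum (x : Ell1) : HasSum (fun n => |x n|) ‖x‖ := by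
  have := lp.hasSum_norm (p := 1) (E := fun _ : ℕ => ℝ) (by simp) x
  simpa using this

lemma sum_eq_of_le {f g : ℕ → ℝ} {A B : ℝ} (hf : HasSum f A) (hg : HasSum g B)
    (hfg : ∀ n, f n ≤ g n) (hBA : B ≤ A) (n : ℕ) : f n = g n := by
  by_contra hne
  have := hasSum_lt (f := f) (g := g) hfg (lt_of_le_of_ne (hfg n) hne) hf hg
  linarith

lemma btw_coord {w a b : Ell1} (hw : ‖w - a‖ + ‖w - b‖ ≤ ‖a - b‖) (n : ℕ) :
    |w n - a n| + |w n - b n| = |a n - b n| := by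
  have h1 := (l1_hasSum (w - a)).add (l1_hasSum (w - b))
  have h2 := l1_hasSum (a - b)
  have := sum_eq_of_le h2 h1 (fun n => ?_) hw n
  · simpa using this.symm
  · have := abs_sub_le (a n) (w n) (b n)
    rw [abs_sub_comm (a n) (w n)] at this
    simpa using this

lemma disj_coord {x y : Ell1} (hp : 2 * ‖x‖ + 2 * ‖y‖ ≤ ‖x + y‖ + ‖x - y‖) (n : ℕ) :
    x n = 0 ∨ y n = 0 := by
  have h1 := (l1_hasSum (x + y)).add (l1_hasSum (x - y))
  have h2 := ((l1_hasSum x).mul_left 2).add ((l1_hasSum y).mul_left 2)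
  have := sum_eq_of_le h1 h2 (fun n => ?_) hp n
  · simp only [lp.coeFn_add, lp.coeFn_sub, Pi.add_apply, Pi.sub_apply] at this
    by_contra hc
    push Not at hc
    have hx := abs_pos.2 hc.1
    have hy := abs_pos.2 hc.2
    rcases abs_cases (x n + y n) with h | h <;> rcases abs_cases (x n - y n) with h' | h' <;>
    rcases abs_cases (x n) with h'' | h'' <;> rcases abs_cases (y n) with h''' | h''' <;> linarith
  · simp only [lp.coeFn_add, lp.coeFn_sub, Pi.add_apply, Pi.sub_apply]
    have := abs_add_le (x n) (y n)
    have := abs_sub (x n) (y n)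
    linarith

lemma norm_fin {x : Ell1} (s : Finset ℕ) (hx : ∀ n ∉ s, x n = 0) : ‖x‖ = ∑ n ∈ s, |x n| := by
  refine (l1_hasSum x).unique (hasSum_sum_of_ne_finset_zero ?_)
  intro n hn; simp [hx n hn]

lemma nu_bound (v : Ell1) (u : Fin 4 → Ell1) (k : ℝ) (hk : 0 ≤ k) (hu : ∀ i, ‖u i‖ = 1)
    (hd : ∀ i j, i ≠ j → ∀ n, u i n = 0 ∨ u j n = 0) :
    4 * k + 2 * ‖v‖ ≤ ∑ i, ‖k • u i + v‖ := by
  have h1 : HasSum (fun n => ∑ i, |(k • u i + v) n|) (∑ i, ‖k • u i + v‖) :=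
    hasSum_sum (fun i _ => l1_hasSum _)
  have h2 : HasSum (fun n => k * ∑ i, |u i n| + 2 * |v n|) (k * ∑ i, ‖u i‖ + 2 * ‖v‖) :=
    ((hasSum_sum (fun i _ => l1_hasSum (u i))).mul_left k).add ((l1_hasSum v).mul_left 2)
  have h3 := hasSum_le (fun n => ?_) h2 h1
  · simp [hu] at h3
    linarith
  · have key : ∀ i, (∀ j, j ≠ i → u j n = 0) →
        k * ∑ i, |u i n| + 2 * |v n| ≤ ∑ i, |(k • u i + v) n| := by
      intro i hi
      have e1 : ∑ i, |u i n| = |u i n| :=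
        Finset.sum_eq_single i (fun j _ hj => by simp [hi j hj]) (by simp)
      have e2 : ∑ j, |(k • u j + v) n| = |k * u i n + v n| + 3 * |v n| := by
        rw [← Finset.add_sum_erase _ _ (Finset.mem_univ i)]
        congr 1
        rw [Finset.sum_congr rfl (g := fun _ => |v n|)]
        · simp
        · intro j hj
          have := hi j (Finset.ne_of_mem_erase hj)
          have e3 : (k • u j + v) n = k * u j n + v n := rfl
          rw [e3, this]; simp
      rw [e1, e2]
      have := abs_sub (k * u i n + v n) (v n)
      rw [add_sub_cancel_right, abs_mul, abs_of_nonneg hk] at this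
      linarith
    by_cases hz : ∃ i, u i n ≠ 0
    · obtain ⟨i, hi⟩ := hz
      exact key i (fun j hj => (hd j i hj n).resolve_right hi)
    · push Not at hz
      exact key 0 (fun j _ => hz j)

noncomputable def mkz (x : Ell1) (t : ℝ) : Z := WithLp.toLp 2 (x, t)

@[simp] lemma mkz_fst (x : Ell1) (t : ℝ) : (mkz x t).fst = x := rfl
@[simp] lemma mkz_snd (x : Ell1) (t : ℝ) : (mkz x t).snd = t := rfl

lemma zext {x y : Z} (h1 : x.fst = y.fst) (h2 : x.snd = y.snd) : x = y := by
  have : x.ofLp = y.ofLp := Prod.ext h1 h2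
  exact WithLp.ofLp_injective 2 this

lemma nsq (z : Z) : ‖z‖ ^ 2 = ‖z.fst‖ ^ 2 + z.snd ^ 2 := by
  rw [WithLp.prod_norm_sq_eq_of_L2, Real.norm_eq_abs, sq_abs]

lemma norm_mkz0 (x : Ell1) : ‖mkz x 0‖ = ‖x‖ := by
  have := nsq (mkz x 0)
  simp only [mkz_fst, mkz_snd] at this
  have h2 : ‖mkz x 0‖ ^ 2 = ‖x‖ ^ 2 := by rw [this]; ring
  exact (sq_eq_sq₀ (norm_nonneg _) (norm_nonneg _)).1 h2

lemma norm_le_of_sq {z : Z} {r : ℝ} (hr : 0 ≤ r) (hz : ‖z.fst‖ ^ 2 + z.snd ^ 2 ≤ r ^ 2) :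
    ‖z‖ ≤ r := by
  rw [← nsq] at hz
  exact (sq_le_sq₀ (norm_nonneg _) hr).1 hz

lemma norm_eq_of_sq {z : Z} {r : ℝ} (hr : 0 ≤ r) (hz : ‖z.fst‖ ^ 2 + z.snd ^ 2 = r ^ 2) :
    ‖z‖ = r := by
  rw [← nsq] at hz
  exact (sq_eq_sq₀ (norm_nonneg _) hr).1 hz

lemma fst_le (z : Z) : ‖z.fst‖ ≤ ‖z‖ := by
  refine (sq_le_sq₀ (norm_nonneg _) (norm_nonneg _)).1 ?_
  rw [nsq z]; nlinarith [sq_nonneg z.snd]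

lemma snd_le (z : Z) : |z.snd| ≤ ‖z‖ := by
  refine abs_le_of_sq_le_sq ?_ (norm_nonneg _)
  rw [nsq z]; nlinarith [sq_nonneg ‖z.fst‖]

lemma cs_real {p f d e l : ℝ} (h0 : 0 ≤ l) (h : p ^ 2 + f ^ 2 ≤ l ^ 2 * (d ^ 2 + e ^ 2)) :
    p * d + f * e ≤ l * (d ^ 2 + e ^ 2) := by
  refine abs_le_of_sq_le_sq' ?_ (by positivity) |>.2
  have : (p * d + f * e) ^ 2 ≤ (p ^ 2 + f ^ 2) * (d ^ 2 + e ^ 2) := by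
    nlinarith [sq_nonneg (p * e - f * d)]
  have h2 := mul_le_mul_of_nonneg_right h (show 0 ≤ d ^ 2 + e ^ 2 by positivity)
  calc _ ≤ _ := this
    _ ≤ _ := h2
    _ = _ := by ring

lemma sq_two {a b : ℝ} (h : a ^ 2 + b ^ 2 ≤ 0) : a = 0 ∧ b = 0 := by
  constructor <;> nlinarith [sq_nonneg a, sq_nonneg b]

lemma btw_real {p q d f g l : ℝ} (h0 : 0 ≤ l) (h1 : l ≤ 1) (hd : 0 ≤ d) 
    (a1 : p ^ 2 + f ^ 2 ≤ l ^ 2 * (d ^ 2 + (f + g) ^ 2))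
    (a2 : q ^ 2 + g ^ 2 ≤ (1 - l) ^ 2 * (d ^ 2 + (f + g) ^ 2)) (a4 : d ≤ p + q) :
    p - l * d = 0 ∧ f - l * (f + g) = 0 ∧ q - (1 - l) * d = 0 := by
  have b1 := cs_real h0 a1
  have b2 := cs_real (by linarith) a2
  have b3 : d * d ≤ (p + q) * d := mul_le_mul_of_nonneg_right a4 hd
  have e1 : p * d + f * (f + g) = l * (d ^ 2 + (f + g) ^ 2) := by
    apply le_antisymm b1; nlinarith
  have e2 : q * d + g * (f + g) = (1 - l) * (d ^ 2 + (f + g) ^ 2) := by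
    apply le_antisymm b2; nlinarith
  have c1 : (p - l * d) ^ 2 + (f - l * (f + g)) ^ 2 ≤ 0 := by
    have : (p - l * d) ^ 2 + (f - l * (f + g)) ^ 2 = p ^ 2 + f ^ 2
      - 2 * l * (p * d + f * (f + g)) + l ^ 2 * (d ^ 2 + (f + g) ^ 2) := by ring
    rw [this, e1]; linarith
  have c2 : (q - (1 - l) * d) ^ 2 + (g - (1 - l) * (f + g)) ^ 2 ≤ 0 := by
    have : (q - (1 - l) * d) ^ 2 + (g - (1 - l) * (f + g)) ^ 2 = q ^ 2 + g ^ 2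
      - 2 * (1 - l) * (q * d + g * (f + g)) + (1 - l) ^ 2 * (d ^ 2 + (f + g) ^ 2) := by ring
    rw [this, e2]; linarith
  exact ⟨(sq_two c1).1, (sq_two c1).2, (sq_two c2).1⟩

/-- metric betweenness in Z -/
lemma btw {A B W : Z} {l : ℝ} (h0 : 0 ≤ l) (h1 : l ≤ 1) (hA : ‖W - A‖ ≤ l * ‖A - B‖)
    (hB : ‖W - B‖ ≤ (1 - l) * ‖A - B‖) :
    W.snd = (1 - l) * A.snd + l * B.snd ∧ ‖W.fst - A.fst‖ = l * ‖A.fst - B.fst‖ ∧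
    ‖W.fst - B.fst‖ = (1 - l) * ‖A.fst - B.fst‖ := by
  have nD := norm_nonneg (A - B)
  have a1 := pow_le_pow_left₀ (norm_nonneg _) hA 2
  have a2 := pow_le_pow_left₀ (norm_nonneg _) hB 2
  have a3 := nsq (A - B)
  rw [mul_pow, a3, nsq] at a1 a2
  simp only [WithLp.sub_fst, WithLp.sub_snd] at a1 a2
  have a4 : ‖A.fst - B.fst‖ ≤ ‖W.fst - A.fst‖ + ‖W.fst - B.fst‖ := by
    rw [norm_sub_rev W.fst A.fst]; exact norm_sub_le_norm_sub_add_norm_sub _ _ _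
  set p := ‖W.fst - A.fst‖
  set q := ‖W.fst - B.fst‖
  set d := ‖A.fst - B.fst‖
  have hd : 0 ≤ d := norm_nonneg _
  have hp : 0 ≤ p := norm_nonneg _
  have hq : 0 ≤ q := norm_nonneg _
  obtain ⟨f, hf⟩ : ∃ f, f = W.snd - A.snd := ⟨_, rfl⟩
  obtain ⟨g, hg⟩ : ∃ g, g = B.snd - W.snd := ⟨_, rfl⟩
  have e1 : A.snd - B.snd = -(f + g) := by rw [hf, hg]; ring
  have e2 : W.snd - B.snd = - g := by rw [hg]; ring
  rw [e1, ← hf] at a1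
  rw [e1, e2] at a2
  obtain ⟨r1, r2, r3⟩ := btw_real h0 h1 hd (by rw [neg_sq] at a1; exact a1)
    (by rw [neg_sq, neg_sq] at a2; exact a2) a4
  refine ⟨?_, by linarith, by linarith⟩
  have : f + g = B.snd - A.snd := by rw [hf, hg]; ring
  rw [this, hf] at r2
  linarith


structure Hyp (F G : Z → Z) : Prop where
  mF : ∀ v, ‖v‖ ≤ 1 → ‖F v‖ ≤ 1
  mG : ∀ v, ‖v‖ ≤ 1 → ‖G v‖ ≤ 1
  FG : ∀ v, ‖v‖ ≤ 1 → F (G v) = v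
  GF : ∀ v, ‖v‖ ≤ 1 → G (F v) = v
  lip : ∀ v w, ‖v‖ ≤ 1 → ‖w‖ ≤ 1 → ‖F v - F w‖ ≤ ‖v - w‖

noncomputable def ee (i : ℕ) : Ell1 := lp.single 1 i (1 : ℝ)

lemma ee_self (i : ℕ) : ee i i = 1 := by simp [ee]
lemma ee_ne {i n : ℕ} (hn : n ≠ i) : ee i n = 0 := by simp [ee, hn]
lemma sm_apply (a : ℝ) (x : Ell1) (n : ℕ) : (a • x) n = a * x n := rfl
lemma ad_apply (x y : Ell1) (n : ℕ) : (x + y) n = x n + y n := rfl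
lemma su_apply (x y : Ell1) (n : ℕ) : (x - y) n = x n - y n := rfl
lemma ne_apply (x : Ell1) (n : ℕ) : (-x) n = - x n := rfl
lemma ze_apply (n : ℕ) : (0 : Ell1) n = 0 := rfl

lemma norm_one {x : Ell1} (i : ℕ) (hx : ∀ n, n ≠ i → x n = 0) : ‖x‖ = |x i| := by
  rw [norm_fin {i} (fun n hn => hx n (by simpa using hn))]; simp

lemma norm_two {x : Ell1} {i j : ℕ} (hij : i ≠ j) (hx : ∀ n, n ≠ i → n ≠ j → x n = 0) :
    ‖x‖ = |x i| + |x j| := by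
  rw [norm_fin {i, j} (fun n hn => hx n (by simp at hn; exact hn.1) (by simp at hn; exact hn.2))]
  rw [Finset.sum_pair hij]

lemma norm_ee (i : ℕ) : ‖ee i‖ = 1 := by
  rw [norm_one i (fun n hn => ee_ne hn), ee_self]; simp

noncomputable def zz (i : ℕ) (c s : ℝ) : Z := mkz (c • ee i) s

lemma zz_neg (i : ℕ) (c s : ℝ) : zz i (-c) (-s) = - zz i c s := by
  apply zext <;> simp [zz]

lemma zz_smul (i : ℕ) (t c s : ℝ) : t • zz i c s = zz i (t * c) (t * s) := by
  apply zext <;> simp [zz, mul_smul]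

lemma norm_zz (i : ℕ) {c s : ℝ} (hcs : c ^ 2 + s ^ 2 = 1) : ‖zz i c s‖ = 1 := by
  apply norm_eq_of_sq zero_le_one
  simp [zz, norm_smul, norm_ee, hcs]

lemma unit_smul {t : ℝ} {z : Z} (h0 : 0 ≤ t) (h1 : t ≤ 1) (hz : ‖z‖ ≤ 1) : ‖t • z‖ ≤ 1 := by
  rw [norm_smul, Real.norm_eq_abs, abs_of_nonneg h0]
  nlinarith [norm_nonneg z]

lemma unit_comb {a b : ℝ} {z w : Z} (h0 : 0 ≤ a) (h1 : 0 ≤ b) (hab : a + b ≤ 1) (hz : ‖z‖ ≤ 1)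
    (hw : ‖w‖ ≤ 1) : ‖a • z + b • w‖ ≤ 1 := by
  refine (norm_add_le _ _).trans ?_
  rw [norm_smul, norm_smul, Real.norm_eq_abs, abs_of_nonneg h0, Real.norm_eq_abs, abs_of_nonneg h1]
  nlinarith [norm_nonneg z, norm_nonneg w]

lemma btw0 {x m d : ℝ} (hm : 0 < m) (hd : d = 1 ∨ d = -1) (hx : |x - d * m| + |x| = |d * m|) :
    0 ≤ d * x ∧ |x| = d * x ∧ |x - d * m| = m - d * x := by
  have key : 0 ≤ d * x ∧ 0 ≤ m - d * x := by
    rcases hd with h | h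
    · subst h
      rw [one_mul, abs_of_pos hm] at hx
      have := neg_abs_le (x - m)
      have := le_abs_self (x - m)
      have := neg_abs_le x
      have := le_abs_self x
      constructor <;> linarith
    · subst h
      rw [show -1 * m = - m by ring, abs_neg, abs_of_pos hm] at hx
      have := neg_abs_le (x - -m)
      have := le_abs_self (x - -m)
      have := neg_abs_le x
      have := le_abs_self x
      constructor <;> linarith
  refine ⟨key.1, ?_, ?_⟩
  · rcases hd with h | h <;> subst h
    · rw [one_mul]; exact abs_of_nonneg (by linarith [key.1])
    · rw [neg_one_mul]; exact abs_of_nonpos (by linarith [key.1])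
  · rcases hd with h | h <;> subst h
    · rw [abs_of_nonpos (by linarith [key.2])]; ring
    · rw [abs_of_nonneg (by linarith [key.2])]; ring

namespace Hyp
variable {F G : Z → Z} (H : Hyp F G)
include H

lemma inj {v w : Z} (hv : ‖v‖ ≤ 1) (hw : ‖w‖ ≤ 1) (e : F v = F w) : v = w := by
  rw [← H.GF v hv, ← H.GF w hw, e]

lemma F0 : F 0 = 0 := by
  by_contra hne
  have hy : 0 < ‖F 0‖ := norm_pos_iff.2 hne
  set y := F 0 with hyd
  have hw : ‖(-(1 / ‖y‖)) • y‖ ≤ 1 := by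
    rw [norm_smul, norm_neg, norm_div, NormOneClass.norm_one, norm_norm]; field_simp; exact le_refl _
  have h1 := H.lip (G ((-(1 / ‖y‖)) • y)) 0 (H.mG _ hw) (by simp)
  rw [H.FG _ hw, ← hyd, sub_zero] at h1
  have h2 := H.mG _ hw
  have e : (-(1 / ‖y‖)) • y - y = (-(1 / ‖y‖ + 1)) • y := by
    rw [neg_smul, neg_smul, add_smul, one_smul]; abel
  rw [e, norm_smul, norm_neg, Real.norm_eq_abs, abs_of_pos (by positivity)] at h1
  have : (1 / ‖y‖ + 1) * ‖y‖ = 1 + ‖y‖ := by field_simp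
  linarith

lemma G0 : G 0 = 0 := by
  have := H.GF 0 (by simp); rwa [H.F0] at this

lemma expa {v w : Z} (hv : ‖v‖ ≤ 1) (hw : ‖w‖ ≤ 1) : ‖v - w‖ ≤ ‖G v - G w‖ := by
  have := H.lip _ _ (H.mG v hv) (H.mG w hw)
  rwa [H.FG _ hv, H.FG _ hw] at this

lemma normF {v : Z} (hv : ‖v‖ ≤ 1) : ‖F v‖ ≤ ‖v‖ := by
  simpa [H.F0] using H.lip v 0 hv (by simp)

lemma normG1 {v : Z} (hv : ‖v‖ = 1) : ‖G v‖ = 1 := by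
  apply le_antisymm (H.mG v hv.le)
  have := H.expa hv.le (w := 0) (by simp)
  simpa [H.G0, hv] using this

lemma seg {P Q : Z} (hP : ‖P‖ ≤ 1) (hQ : ‖Q‖ ≤ 1) (hPQ : ‖P - Q‖ ≤ ‖F P - F Q‖) {l : ℝ}
    (h0 : 0 ≤ l) (h1 : l ≤ 1) {W : Z} (hW : W = F ((1 - l) • P + l • Q)) :
    W.snd = (1 - l) * (F P).snd + l * (F Q).snd ∧
    ‖W.fst - (F P).fst‖ = l * ‖(F P).fst - (F Q).fst‖ ∧
    ∀ n, |W.fst n - (F P).fst n| + |W.fst n - (F Q).fst n| = |(F P).fst n - (F Q).fst n| := by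
  have hv : ‖(1 - l) • P + l • Q‖ ≤ 1 := unit_comb (by linarith) h0 (by linarith) hP hQ
  have a1 := H.lip _ _ hv hP
  have a2 := H.lip _ _ hv hQ
  have e1 : (1 - l) • P + l • Q - P = (-l) • (P - Q) := by
    rw [smul_sub, sub_smul, one_smul, neg_smul, neg_smul]; abel
  have e2 : (1 - l) • P + l • Q - Q = (1 - l) • (P - Q) := by
    rw [smul_sub, sub_smul 1 l Q, one_smul]; abel
  rw [e1, norm_smul, norm_neg, Real.norm_eq_abs, abs_of_nonneg h0, ← hW] at a1
  rw [e2, norm_smul, Real.norm_eq_abs, abs_of_nonneg (by linarith), ← hW] at a2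
  obtain ⟨b1, b2, b3⟩ := btw h0 h1 (a1.trans (mul_le_mul_of_nonneg_left hPQ h0))
    (a2.trans (mul_le_mul_of_nonneg_left hPQ (by linarith)))
  refine ⟨b1, b2, btw_coord ?_⟩
  rw [b2, b3]; linarith

lemma seg_ext {P Q : Z} (hP : ‖P‖ ≤ 1) (hQ : ‖Q‖ ≤ 1) (hPQ : ‖P - Q‖ ≤ ‖F P - F Q‖) {l : ℝ}
    (h0 : 0 ≤ l) (h1 : l ≤ 1) {i : ℕ} {a b s t : ℝ} (eP : F P = zz i a s) (eQ : F Q = zz i b t) :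
    F ((1 - l) • P + l • Q) = zz i ((1 - l) * a + l * b) ((1 - l) * s + l * t) := by
  obtain ⟨W, hW⟩ : ∃ W, W = F ((1 - l) • P + l • Q) := ⟨_, rfl⟩
  obtain ⟨b1, b2, b3⟩ := H.seg hP hQ hPQ h0 h1 hW
  rw [← hW]
  rw [eP, eQ] at b1 b2 b3
  simp only [zz, mkz_fst, mkz_snd] at b1 b2 b3
  have c0 : ∀ n, n ≠ i → W.fst n = 0 := by
    intro n hn
    have := b3 n
    simp only [sm_apply, ee_ne hn, mul_zero, sub_zero, abs_zero] at this
    exact abs_eq_zero.1 (by linarith)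
  have c1 := b3 i
  rw [norm_one i (fun n hn => by simp [su_apply, sm_apply, ee_ne hn, c0 n hn]),
    norm_one i (fun n hn => by simp [su_apply, sm_apply, ee_ne hn])] at b2
  simp only [su_apply, sm_apply, ee_self, mul_one] at b2 c1
  apply zext
  · ext n
    by_cases hn : n = i
    · subst hn
      simp only [zz, mkz_fst, sm_apply, ee_self, mul_one]
      rcases abs_cases (W.fst n - a) with ⟨h, h'⟩ | ⟨h, h'⟩ <;>
      rcases abs_cases (W.fst n - b) with ⟨k, k'⟩ | ⟨k, k'⟩ <;>
      rcases abs_cases (a - b) with ⟨m, m'⟩ | ⟨m, m'⟩ <;> rw [h, m] at b2 <;> rw [h, k, m] at c1 <;>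
        nlinarith
    · rw [c0 n hn]; simp [zz, sm_apply, ee_ne hn]
  · rw [b1]; rfl

lemma homog (i : ℕ) {c s t : ℝ} (hcs : c ^ 2 + s ^ 2 = 1) (h0 : 0 ≤ t) (h1 : t ≤ 1) :
    F (t • G (zz i c s)) = t • zz i c s := by
  have hz := norm_zz i hcs
  have := H.seg_ext (P := 0) (Q := G (zz i c s)) (by simp) (H.mG _ hz.le)
    (by rw [H.F0, H.FG _ hz.le, zero_sub, zero_sub, norm_neg, norm_neg, hz]; exact H.mG _ hz.le)
    h0 h1 (i := i) (a := 0) (s := 0) (by rw [H.F0]; apply zext <;> simp [zz]) (H.FG _ hz.le)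
  rw [zz_smul]
  simpa using this

lemma odd (i : ℕ) {c s : ℝ} (hcs : c ^ 2 + s ^ 2 = 1) :
    G (zz i (-c) (-s)) = - G (zz i c s) := by
  have hz := norm_zz i hcs
  have hz' : ‖zz i (-c) (-s)‖ = 1 := norm_zz i (by linarith)
  have m1 := H.mG _ hz.le
  have m2 := H.mG _ hz'.le
  have := H.seg_ext (P := G (zz i c s)) (Q := G (zz i (-c) (-s))) m1 m2
    (by
      rw [H.FG _ hz.le, H.FG _ hz'.le, zz_neg, sub_neg_eq_add, ← two_smul ℝ, norm_smul, hz]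
      rw [zz_neg] at m2
      have := norm_sub_le (G (zz i c s)) (G (-zz i c s))
      simp
      linarith) (l := 1 / 2) (by norm_num) (by norm_num) (H.FG _ hz.le) (H.FG _ hz'.le)
  have e : zz i ((1 - 1 / 2) * c + 1 / 2 * -c) ((1 - 1 / 2) * s + 1 / 2 * -s) = 0 := by
    apply zext <;> simp [zz] <;> ring_nf <;> simp
  rw [e, ← H.F0] at this
  have := H.inj (unit_comb (by norm_num) (by norm_num) (by norm_num) m1 m2) (by simp) this
  have h2 : (1 / 2 : ℝ) • (G (zz i c s) + G (zz i (-c) (-s))) = 0 := by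
    rw [← this, smul_add]; norm_num
  have h3 := (smul_eq_zero.1 h2).resolve_left (by norm_num)
  exact (neg_eq_of_add_eq_zero_right h3).symm

lemma pairseg {i j : ℕ} (hij : i ≠ j) {d d' c s : ℝ} (hd : d = 1 ∨ d = -1) (hd' : d' = 1 ∨ d' = -1)
    (hc : 0 < c) (hcs : c ^ 2 + s ^ 2 = 1) {a b : ℝ} (ha : 0 ≤ a) (hb : 0 ≤ b) (hab : a + b ≤ 1) :
    ∃ p q : ℝ, 0 ≤ p ∧ 0 ≤ q ∧ p - q = a - b ∧
      F (a • G (zz i (d * c) s) + b • G (zz j (d' * c) (-s))) =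
        mkz ((p * (d * c)) • ee i + (q * (d' * c)) • ee j) ((a - b) * s) := by
  have hd1 : d * d = 1 := by rcases hd with h | h <;> rw [h] <;> norm_num
  have hd1' : d' * d' = 1 := by rcases hd' with h | h <;> rw [h] <;> norm_num
  have ad : |d| = 1 := by rcases hd with h | h <;> rw [h] <;> norm_num
  have ad' : |d'| = 1 := by rcases hd' with h | h <;> rw [h] <;> norm_num
  have u1 : (d * c) ^ 2 + s ^ 2 = 1 := by rw [← hcs]; linear_combination c ^ 2 * hd1
  have u2 : (d' * c) ^ 2 + (-s) ^ 2 = 1 := by rw [← hcs]; linear_combination c ^ 2 * hd1'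
  rcases (add_nonneg ha hb).eq_or_lt with h0 | hA
  · have ha0 : a = 0 := by linarith
    have hb0 : b = 0 := by linarith
    refine ⟨0, 0, le_refl _, le_refl _, by linarith, ?_⟩
    rw [ha0, hb0]; simp only [zero_smul, add_zero, H.F0]
    apply zext <;> simp
  obtain ⟨A, hAd⟩ : ∃ A, A = a + b := ⟨_, rfl⟩
  rw [← hAd] at hA hab
  have n1 := H.mG _ (norm_zz i u1).le
  have n2 := H.mG _ (norm_zz j u2).le
  have f1 := H.homog i u1 hA.le hab
  have f2 := H.homog j u2 hA.le hab
  obtain ⟨W, hW⟩ : ∃ W, W = F ((1 - b / A) • A • G (zz i (d * c) s)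
    + (b / A) • A • G (zz j (d' * c) (-s))) := ⟨_, rfl⟩
  have nn : ‖(d * c) • ee i - (d' * c) • ee j‖ = 2 * c := by
    rw [norm_two hij (fun n h1 h2 => by simp [su_apply, sm_apply, ee_ne h1, ee_ne h2])]
    simp only [su_apply, sm_apply, ee_ne hij, ee_ne hij.symm, ee_self]
    simp [abs_mul, ad, ad', abs_of_pos hc]; ring
  have nd : ‖zz i (d * c) s - zz j (d' * c) (-s)‖ = 2 := by
    apply norm_eq_of_sq (by norm_num)
    simp only [zz, WithLp.sub_fst, WithLp.sub_snd, mkz_fst, mkz_snd, nn]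
    linear_combination 4 * hcs
  obtain ⟨b1, b2, b3⟩ := H.seg (unit_smul hA.le hab n1) (unit_smul hA.le hab n2)
    (by rw [f1, f2, ← smul_sub, ← smul_sub, norm_smul, norm_smul, nd]
        refine mul_le_mul_of_nonneg_left ?_ (norm_nonneg _)
        have := norm_sub_le (G (zz i (d * c) s)) (G (zz j (d' * c) (-s)))
        linarith) (l := b / A) (by positivity) (by rw [div_le_one hA]; linarith) hW
  have e1 : (1 - b / A) * A = a := by field_simp; linarith
  have e2 : (b / A) * A = b := by field_simp
  rw [smul_smul, smul_smul, e1, e2] at hW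
  rw [f1, f2] at b1 b2 b3
  simp only [zz, WithLp.smul_fst, WithLp.smul_snd, mkz_fst, mkz_snd] at b1 b2 b3
  have c0 : ∀ n, n ≠ i → n ≠ j → W.fst n = 0 := by
    intro n hn hn'
    have := b3 n
    simp only [sm_apply, ee_ne hn, ee_ne hn', mul_zero, sub_zero, abs_zero] at this
    exact abs_eq_zero.1 (by linarith)
  have ci := b3 i
  have cj := b3 j
  rw [← smul_sub, norm_smul, nn, Real.norm_eq_abs, abs_of_pos hA, norm_two hij (fun n h1 h2 => by
    simp [su_apply, sm_apply, ee_ne h1, ee_ne h2, c0 n h1 h2])] at b2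
  simp only [su_apply, sm_apply, ee_self, ee_ne hij, ee_ne hij.symm, mul_one, mul_zero, sub_zero,
    zero_sub, abs_neg] at b2 ci cj
  have e3 : b / A * (A * (2 * c)) = 2 * b * c := by field_simp
  rw [e3] at b2
  rw [show A * (d * c) = d * (A * c) by ring] at ci b2
  rw [show A * (d' * c) = d' * (A * c) by ring] at cj
  have hp : 0 < A * c := by positivity
  obtain ⟨x1, x2, x3⟩ := btw0 hp hd ci
  obtain ⟨y1, y2, y3⟩ := btw0 hp hd' (by rw [add_comm]; exact cj)
  refine ⟨d * W.fst i / c, d' * W.fst j / c, div_nonneg x1 hc.le, div_nonneg y1 hc.le, ?_, ?_⟩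
  · rw [← sub_div, div_eq_iff hc.ne']
    rw [x3, y2] at b2
    rw [hAd] at b2; linarith
  · rw [← hW]
    have k1 : d * W.fst i / c * (d * c) = W.fst i := by
      field_simp; linear_combination W.fst i * hd1
    have k2 : d' * W.fst j / c * (d' * c) = W.fst j := by
      field_simp; linear_combination W.fst j * hd1'
    rw [k1, k2]
    apply zext
    · ext n
      simp only [mkz_fst, ad_apply, sm_apply]
      by_cases hn : n = i
      · subst hn; simp [ee_self, ee_ne hij]
      · by_cases hn' : n = j
        · subst hn'; simp [ee_self, ee_ne hn]
        · simp [ee_ne hn, ee_ne hn', c0 n hn hn']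
    · simp only [mkz_snd]; rw [b1]
      linear_combination s * (e1 - e2)


end Hyp

lemma coord_le (x : Ell1) (n : ℕ) : |x n| ≤ ‖x‖ := by
  have := lp.norm_apply_le_norm (p := 1) (E := fun _ : ℕ => ℝ) (by simp) x n
  simpa using this

noncomputable def uu (G : Z → Z) (i : ℕ) : Ell1 := (G (zz i 1 0)).fst

lemma real1 {x y s t a b : ℝ} (hx : x ^ 2 + s ^ 2 = 1) (hy : y ^ 2 + t ^ 2 = 1) (x0 : 0 ≤ x)
    (y0 : 0 ≤ y) (ha0 : 0 ≤ a) (hb0 : 0 ≤ b)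
    (ha : a ≤ x + y) (hb : b ≤ x + y) (h1 : 4 ≤ a ^ 2 + (s + t) ^ 2) (h2 : 4 ≤ b ^ 2 + (s - t) ^ 2) :
    s = 0 ∧ t = 0 ∧ x = 1 ∧ y = 1 ∧ 2 ≤ a ∧ 2 ≤ b := by
  have a2 : a ^ 2 ≤ (x + y) ^ 2 := pow_le_pow_left₀ ha0 ha 2
  have b2 : b ^ 2 ≤ (x + y) ^ 2 := pow_le_pow_left₀ hb0 hb 2
  have hxy : 2 ≤ 2 * (x * y) := by linarith [sq_nonneg s, sq_nonneg t,
    show (x + y) ^ 2 = x ^ 2 + 2 * (x * y) + y ^ 2 by ring, show (s + t) ^ 2 + (s - t) ^ 2 = 2 * s ^ 2 + 2 * t ^ 2 by ring]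
  have x1 : x ≤ 1 := by nlinarith [sq_nonneg s]
  have y1 : y ≤ 1 := by nlinarith [sq_nonneg t]
  have hx1 : x = 1 := le_antisymm x1 (by linarith [mul_le_mul_of_nonneg_left y1 x0])
  have hy1 : y = 1 := le_antisymm y1 (by linarith [mul_le_mul_of_nonneg_right x1 y0])
  have hs : s = 0 := by rw [hx1] at hx; exact pow_eq_zero_iff two_ne_zero |>.1 (by linarith)
  have ht : t = 0 := by rw [hy1] at hy; exact pow_eq_zero_iff two_ne_zero |>.1 (by linarith)
  subst hs ht
  have p1 : (2 : ℝ) ^ 2 ≤ a ^ 2 := by norm_num at h1 ⊢; exact h1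
  have p2 : (2 : ℝ) ^ 2 ≤ b ^ 2 := by norm_num at h2 ⊢; exact h2
  exact ⟨rfl, rfl, hx1, hy1, (sq_le_sq₀ (by norm_num) ha0).1 p1, (sq_le_sq₀ (by norm_num) hb0).1 p2⟩

namespace Hyp
variable {F G : Z → Z} (H : Hyp F G)
include H

lemma u_pair {i j : ℕ} (hij : i ≠ j) :
    (G (zz i 1 0)).snd = 0 ∧ ‖uu G i‖ = 1 ∧ ∀ n, uu G i n = 0 ∨ uu G j n = 0 := by
  have hi := norm_zz i (c := 1) (s := 0) (by norm_num)
  have hj := norm_zz j (c := 1) (s := 0) (by norm_num)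
  have hj' := norm_zz j (c := -1) (s := 0) (by norm_num)
  have g1 := H.normG1 hi
  have g2 := H.normG1 hj
  have e1 := H.expa hi.le hj.le
  have e2 := H.expa hi.le hj'.le
  have o := H.odd j (c := 1) (s := 0) (by norm_num)
  rw [neg_zero] at o
  rw [o, sub_neg_eq_add] at e2
  have n1 : ‖zz i 1 0 - zz j 1 0‖ = 2 := by
    apply norm_eq_of_sq (by norm_num)
    simp only [zz, WithLp.sub_fst, WithLp.sub_snd, mkz_fst, mkz_snd]
    rw [norm_two hij (fun n h1 h2 => by simp [su_apply, ee_ne h1, ee_ne h2])]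
    simp [su_apply, ee_ne hij, ee_ne hij.symm, ee_self]; norm_num
  have n2 : ‖zz i 1 0 - zz j (-1) 0‖ = 2 := by
    apply norm_eq_of_sq (by norm_num)
    simp only [zz, WithLp.sub_fst, WithLp.sub_snd, mkz_fst, mkz_snd]
    rw [norm_two hij (fun n h1 h2 => by simp [ad_apply, ee_ne h1, ee_ne h2])]
    simp [ad_apply, ee_ne hij, ee_ne hij.symm, ee_self]; norm_num
  rw [n1] at e1
  rw [n2] at e2
  have s1 := nsq (G (zz i 1 0))
  have s2 := nsq (G (zz j 1 0))
  have s3 := nsq (G (zz i 1 0) - G (zz j 1 0))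
  have s4 := nsq (G (zz i 1 0) + G (zz j 1 0))
  simp only [WithLp.sub_fst, WithLp.sub_snd, WithLp.add_fst, WithLp.add_snd] at s3 s4
  rw [g1, one_pow] at s1
  rw [g2, one_pow] at s2
  obtain ⟨r1, r2, r3, r4, r5, r6⟩ := real1 s1.symm s2.symm (norm_nonneg _) (norm_nonneg _)
    (norm_nonneg _) (norm_nonneg _) (norm_add_le _ _) (norm_sub_le _ _)
    (by rw [← s4]; nlinarith) (by rw [← s3]; nlinarith)
  refine ⟨r1, r3, disj_coord ?_⟩
  unfold uu
  rw [r3, r4]; linarith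

lemma u_snd (i : ℕ) : (G (zz i 1 0)).snd = 0 := (H.u_pair (Nat.succ_ne_self i).symm).1
lemma u_norm (i : ℕ) : ‖uu G i‖ = 1 := (H.u_pair (Nat.succ_ne_self i).symm).2.1
lemma u_disj {i j : ℕ} (hij : i ≠ j) (n : ℕ) : uu G i n = 0 ∨ uu G j n = 0 := (H.u_pair hij).2.2 n
lemma u_nz (i : ℕ) : ∃ n, uu G i n ≠ 0 := by
  by_contra hc
  push Not at hc
  have : uu G i = 0 := by ext n; exact hc n
  have h1 := H.u_norm i
  rw [this] at h1; simp at h1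

lemma G_u (i : ℕ) {d : ℝ} (hd : d = 1 ∨ d = -1) : G (zz i d 0) = mkz (d • uu G i) 0 := by
  have e : G (zz i 1 0) = mkz (uu G i) 0 := zext rfl (H.u_snd i)
  rcases hd with h | h <;> subst h
  · rw [e]; simp
  · have o := H.odd i (c := 1) (s := 0) (by norm_num)
    rw [neg_zero] at o
    rw [o, e]; apply zext <;> simp

lemma cont_coord {γ : ℝ → Z} {s : Set ℝ} (hγ : ContinuousOn γ s) (hb : ∀ t ∈ s, ‖γ t‖ ≤ 1) (n : ℕ) :
    ContinuousOn (fun t => (F (γ t)).fst n) s := by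
  rw [Metric.continuousOn_iff] at hγ ⊢
  intro b hbs ε hε
  obtain ⟨δ, hδ, hh⟩ := hγ b hbs ε hε
  refine ⟨δ, hδ, fun a ha hab => lt_of_le_of_lt ?_ (hh a ha hab)⟩
  rw [Real.dist_eq, dist_eq_norm]
  refine le_trans ?_ (H.lip _ _ (hb a ha) (hb b hbs))
  refine le_trans ?_ (fst_le _)
  exact coord_le ((F (γ a)).fst - (F (γ b)).fst) n

lemma diag {i j : ℕ} (hij : i ≠ j) {d d' c s : ℝ} (hd : d = 1 ∨ d = -1) (hd' : d' = 1 ∨ d' = -1)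
    (hc : 0 < c) (hcs : c ^ 2 + s ^ 2 = 1) :
    ∃ τ : ℝ, 0 < τ ∧ ∀ ε, 0 ≤ ε → ε ≤ τ → ∃ σ : ℝ, 0 ≤ σ ∧ σ ≤ 1 / 2 ∧
      F (σ • (G (zz i (d * c) s) + G (zz j (d' * c) (-s)))) =
        mkz ((ε * d) • ee i + (ε * d') • ee j) 0 := by
  have hd1 : d * d = 1 := by rcases hd with h | h <;> rw [h] <;> norm_num
  have hd1' : d' * d' = 1 := by rcases hd' with h | h <;> rw [h] <;> norm_num
  have u1 : (d * c) ^ 2 + s ^ 2 = 1 := by rw [← hcs]; linear_combination c ^ 2 * hd1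
  have u2 : (d' * c) ^ 2 + (-s) ^ 2 = 1 := by rw [← hcs]; linear_combination c ^ 2 * hd1'
  have z1 := norm_zz i u1
  have z2 := norm_zz j u2
  have n1 := H.mG _ z1.le
  have n2 := H.mG _ z2.le
  have key : ∀ σ : ℝ, 0 ≤ σ → σ ≤ 1 / 2 → ∃ e, 0 ≤ e ∧
      F (σ • (G (zz i (d * c) s) + G (zz j (d' * c) (-s)))) =
        mkz ((e * d) • ee i + (e * d') • ee j) 0 := by
    intro σ h0 h1
    obtain ⟨p, q, hp, hq, hpq, e⟩ := H.pairseg hij hd hd' hc hcs h0 h0 (by linarith)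
    have : q = p := by linarith
    subst this
    refine ⟨q * c, by positivity, ?_⟩
    rw [smul_add, e]; congr 1
    · congr 2 <;> ring
    · ring
  have bd : ∀ σ : ℝ, 0 ≤ σ → σ ≤ 1 / 2 → ‖σ • (G (zz i (d * c) s) + G (zz j (d' * c) (-s)))‖ ≤ 1 := by
    intro σ h0 h1
    rw [smul_add]; exact unit_comb h0 h0 (by linarith) n1 n2
  have val : ∀ e : ℝ, d * (mkz ((e * d) • ee i + (e * d') • ee j) 0).fst i = e := by
    intro e
    simp only [mkz_fst, ad_apply, sm_apply, ee_self, ee_ne hij]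
    linear_combination e * hd1
  have cont : ContinuousOn (fun σ : ℝ => d * (F (σ • (G (zz i (d * c) s)
      + G (zz j (d' * c) (-s))))).fst i) (Set.Icc 0 (1 / 2)) := by
    refine continuousOn_const.mul (H.cont_coord (by fun_prop) ?_ i)
    intro t ht; exact bd t ht.1 ht.2
  obtain ⟨τ, hτ, eτ⟩ := key (1 / 2) (by norm_num) le_rfl
  refine ⟨τ, lt_of_le_of_ne hτ ?_, ?_⟩
  · rintro rfl
    simp only [zero_mul, zero_smul, add_zero] at eτ
    have e0 : mkz 0 0 = F 0 := by rw [H.F0]; apply zext <;> simp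
    rw [e0] at eτ
    have := H.inj (bd _ (by norm_num) le_rfl) (by simp) eτ
    have h3 := (smul_eq_zero.1 this).resolve_left (by norm_num)
    have h4 := (neg_eq_of_add_eq_zero_right h3).symm
    rw [← H.odd i u1] at h4
    have h5 := congrArg F h4
    rw [H.FG _ z2.le, H.FG _ (norm_zz i (by linarith)).le] at h5
    have h6 := congrArg (fun z : Z => z.fst j) h5
    simp only [zz, mkz_fst, sm_apply, ee_self, ee_ne hij.symm, mul_one, mul_zero] at h6
    have h6 := (mul_eq_zero.1 h6).resolve_right hc.ne'
    rw [h6] at hd1'; simp at hd1'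
  · intro ε h0 h1
    have iv := intermediate_value_Icc (by norm_num) cont
    have hm : ε ∈ Set.Icc (d * (F ((0 : ℝ) • (G (zz i (d * c) s)
      + G (zz j (d' * c) (-s))))).fst i) (d * (F ((1 / 2 : ℝ) • (G (zz i (d * c) s)
      + G (zz j (d' * c) (-s))))).fst i) := by
      rw [eτ, val, zero_smul, H.F0]
      constructor
      · simpa [ze_apply] using h0
      · exact h1
    obtain ⟨σ, hσ, e⟩ := iv hm
    obtain ⟨e', he', ee'⟩ := key σ hσ.1 hσ.2
    refine ⟨σ, hσ.1, hσ.2, ?_⟩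
    have : e' = ε := by
      rw [← e]; simp only; rw [ee', val]
    rw [ee', this]

lemma prop {i j : ℕ} (hij : i ≠ j) {d d' c s : ℝ} (hd : d = 1 ∨ d = -1) (hd' : d' = 1 ∨ d' = -1)
    (hc : 0 < c) (hcs : c ^ 2 + s ^ 2 = 1) :
    ∃ κ : ℝ, 0 < κ ∧ G (zz i (d * c) s) + G (zz j (d' * c) (-s)) =
      mkz (κ • (d • uu G i + d' • uu G j)) 0 := by
  obtain ⟨τ, hτ, k⟩ := H.diag hij hd hd' hc hcs
  obtain ⟨τ', hτ', k'⟩ := H.diag hij hd hd' (c := 1) (s := 0) (by norm_num) (by norm_num)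
  have hd1 : d * d = 1 := by rcases hd with h | h <;> rw [h] <;> norm_num
  have hd1' : d' * d' = 1 := by rcases hd' with h | h <;> rw [h] <;> norm_num
  have u1 : (d * c) ^ 2 + s ^ 2 = 1 := by rw [← hcs]; linear_combination c ^ 2 * hd1
  have u2 : (d' * c) ^ 2 + (-s) ^ 2 = 1 := by rw [← hcs]; linear_combination c ^ 2 * hd1'
  have n1 := H.mG _ (norm_zz i u1).le
  have n2 := H.mG _ (norm_zz j u2).le
  have hd2 : d ^ 2 + (0 : ℝ) ^ 2 = 1 := by linear_combination hd1
  have hd2' : d' ^ 2 + (0 : ℝ) ^ 2 = 1 := by linear_combination hd1'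
  have n3 := H.mG _ (norm_zz i hd2).le
  have n4 := H.mG _ (norm_zz j hd2').le
  have hε : 0 < min τ τ' := lt_min hτ hτ'
  obtain ⟨σ, s0, s1, e⟩ := k (min τ τ') hε.le (min_le_left _ _)
  obtain ⟨σ', s0', s1', e'⟩ := k' (min τ τ') hε.le (min_le_right _ _)
  rw [mul_one, mul_one, neg_zero] at e'
  have nz : mkz ((min τ τ' * d) • ee i + (min τ τ' * d') • ee j) 0 ≠ 0 := by
    intro h0
    have := congrArg (fun z : Z => z.fst i) h0
    simp [ad_apply, sm_apply, ee_self, ee_ne hij, hε.ne', ze_apply] at this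
    rw [this] at hd1; simp at hd1
  have p1 : 0 < σ := by
    refine lt_of_le_of_ne s0 ?_
    rintro rfl
    rw [zero_smul, H.F0] at e; exact nz e.symm
  have p1' : 0 < σ' := by
    refine lt_of_le_of_ne s0' ?_
    rintro rfl
    rw [zero_smul, H.F0] at e'; exact nz e'.symm
  have := H.inj (by rw [smul_add]; exact unit_comb s0 s0 (by linarith) n1 n2)
    (by rw [smul_add]; exact unit_comb s0' s0' (by linarith) n3 n4) (e.trans e'.symm)
  refine ⟨σ⁻¹ * σ', by positivity, ?_⟩
  have h2 := congrArg (fun z => σ⁻¹ • z) this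
  simp only [smul_smul, inv_mul_cancel₀ p1.ne', one_smul] at h2
  rw [h2, H.G_u i hd, H.G_u j hd']
  apply zext <;> simp

end Hyp

lemma real2 {k v R e : ℝ} (hk : 4 / 5 ≤ k) (hv : 0 ≤ v) (hR : k + v / 2 ≤ R)
    (h1 : R ^ 2 + e ^ 2 = 1) (h2 : 9 / 25 ≤ v ^ 2 + e ^ 2) (h3 : v ≤ 1) : v = 0 := by
  have a : (k + v / 2) ^ 2 ≤ R ^ 2 := pow_le_pow_left₀ (by linarith) hR 2
  have b : (4 / 5 : ℝ) ^ 2 ≤ k ^ 2 := pow_le_pow_left₀ (by norm_num) hk 2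
  have c : k * v ≤ 3 / 4 * v ^ 2 := by
    have : (k + v / 2) ^ 2 = k ^ 2 + k * v + v ^ 2 / 4 := by ring
    norm_num at b
    linarith
  have d : 4 / 5 * v ≤ k * v := mul_le_mul_of_nonneg_right hk hv
  have e : v ^ 2 ≤ v := by nlinarith
  linarith

namespace Hyp
variable {F G : Z → Z} (H : Hyp F G)
include H

lemma diffX {i j : ℕ} (hij : i ≠ j) {c s : ℝ} (hc : 0 < c) (hcs : c ^ 2 + s ^ 2 = 1) :
    ∃ κ : ℝ, 0 < κ ∧ G (zz i c s) - G (zz j c s) = mkz (κ • (uu G i - uu G j)) 0 := by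
  obtain ⟨κ, h0, e⟩ := H.prop hij (d := 1) (d' := -1) (by simp) (by simp) hc hcs
  refine ⟨κ, h0, ?_⟩
  rw [one_mul, neg_one_mul, H.odd j hcs, ← sub_eq_add_neg] at e
  rw [e]; simp [sub_eq_add_neg]

lemma sumX {i j : ℕ} (hij : i ≠ j) {c s : ℝ} (hc : 0 < c) (hcs : c ^ 2 + s ^ 2 = 1) :
    ∃ κ : ℝ, 0 < κ ∧ G (zz i c s) + G (zz j c (-s)) = mkz (κ • (uu G i + uu G j)) 0 := by
  obtain ⟨κ, h0, e⟩ := H.prop hij (d := 1) (d' := 1) (by simp) (by simp) hc hcs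
  refine ⟨κ, h0, ?_⟩
  rw [one_mul] at e
  rw [e]; simp

lemma family {c s : ℝ} (hc : 0 < c) (hcs : c ^ 2 + s ^ 2 = 1) :
    ∃ (κ : ℝ) (V : Z), 0 < κ ∧ ∀ j, G (zz j c s) = mkz (κ • uu G j) 0 + V := by
  obtain ⟨κ, h0, e⟩ := H.diffX (i := 0) (j := 1) (by norm_num) hc hcs
  obtain ⟨n, hn⟩ := H.u_nz 0
  have hz : ∀ j, j ≠ 0 → uu G j n = 0 := fun j hj => (H.u_disj hj n).resolve_right hn
  refine ⟨κ, G (zz 0 c s) - mkz (κ • uu G 0) 0, h0, ?_⟩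
  have main : ∀ j, j ≠ 0 → G (zz 0 c s) - G (zz j c s) = mkz (κ • (uu G 0 - uu G j)) 0 := by
    intro j hj
    by_cases h1 : j = 1
    · rw [h1]; exact e
    obtain ⟨k, k0, e1⟩ := H.diffX (i := 0) (j := j) (Ne.symm hj) hc hcs
    obtain ⟨k', k0', e2⟩ := H.diffX (i := 1) (j := j) (Ne.symm h1) hc hcs
    have e3 : mkz (k • (uu G 0 - uu G j)) 0 - mkz (κ • (uu G 0 - uu G 1)) 0
        = mkz (k' • (uu G 1 - uu G j)) 0 := by
      rw [← e1, ← e, ← e2]; abel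
    have e4 := congrArg (fun z : Z => z.fst n) e3
    simp only [WithLp.sub_fst, mkz_fst, su_apply, sm_apply, hz j hj, hz 1 one_ne_zero] at e4
    have : k = κ := by
      have : (k - κ) * uu G 0 n = 0 := by linarith
      have := (mul_eq_zero.1 this).resolve_right hn
      linarith
    rw [e1, this]
  intro j
  by_cases hj : j = 0
  · rw [hj]; abel
  · have e1 := main j hj
    have e2 : mkz (κ • (uu G 0 - uu G j)) 0 = mkz (κ • uu G 0) 0 - mkz (κ • uu G j) 0 := by
      apply zext <;> simp [smul_sub]
    rw [e2] at e1
    rw [sub_eq_iff_eq_add] at e1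
    rw [e1]; abel

lemma family2 {c s : ℝ} (hc : 0 < c) (hcs : c ^ 2 + s ^ 2 = 1) :
    ∃ (κ : ℝ) (V : Z), 0 < κ ∧ (∀ j, G (zz j c s) = mkz (κ • uu G j) 0 + V) ∧
      ∀ j, G (zz j c (-s)) = mkz (κ • uu G j) 0 - V := by
  obtain ⟨κ, V, h0, e⟩ := H.family hc hcs
  obtain ⟨κ', V', h0', e'⟩ := H.family (s := -s) hc (by linarith)
  obtain ⟨k, k0, e1⟩ := H.sumX (i := 0) (j := 1) (by norm_num) hc hcs
  obtain ⟨k', k0', e2⟩ := H.sumX (i := 2) (j := 3) (by norm_num) hc hcs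
  rw [e, e'] at e1 e2
  have s1 := congrArg (fun z : Z => z.snd) e1
  simp only [WithLp.add_snd, mkz_snd] at s1
  have f1 : ∀ n, κ * uu G 0 n + V.fst n + (κ' * uu G 1 n + V'.fst n)
      = k * (uu G 0 n + uu G 1 n) := fun n => congrArg (fun z : Z => z.fst n) e1
  have f2 : ∀ n, κ * uu G 2 n + V.fst n + (κ' * uu G 3 n + V'.fst n)
      = k' * (uu G 2 n + uu G 3 n) := fun n => congrArg (fun z : Z => z.fst n) e2
  have z2 : ∀ i n, uu G i n ≠ 0 → ∀ j, j ≠ i → uu G j n = 0 :=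
    fun i n hn j hj => (H.u_disj hj n).resolve_right hn
  have a1 : κ = k := by
    obtain ⟨n, hn⟩ := H.u_nz 0
    have g1 := f1 n
    have g2 := f2 n
    rw [z2 0 n hn 1 (by norm_num)] at g1
    rw [z2 0 n hn 2 (by norm_num), z2 0 n hn 3 (by norm_num)] at g2
    exact mul_right_cancel₀ hn (by linarith)
  have a2 : κ' = k := by
    obtain ⟨n, hn⟩ := H.u_nz 1
    have g1 := f1 n
    have g2 := f2 n
    rw [z2 1 n hn 0 (by norm_num)] at g1
    rw [z2 1 n hn 2 (by norm_num), z2 1 n hn 3 (by norm_num)] at g2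
    exact mul_right_cancel₀ hn (by linarith)
  have hV : V' = -V := by
    apply zext
    · ext n
      have g1 := f1 n
      rw [a1, a2] at g1
      simp only [WithLp.neg_fst, ne_apply]
      linarith
    · simp only [WithLp.neg_snd]; linarith
  refine ⟨κ, V, h0, e, fun j => ?_⟩
  rw [e' j, a2, a1, hV, sub_eq_add_neg]

lemma axis0 : ∃ η : ℝ, (η = 1 ∨ η = -1) ∧
    G (zz 0 (4 / 5) (3 / 5)) = mkz ((4 / 5 : ℝ) • uu G 0) (η * (3 / 5)) ∧
    G (zz 0 (4 / 5) (-(3 / 5))) = mkz ((4 / 5 : ℝ) • uu G 0) (-(η * (3 / 5))) := by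
  have hcs : (4 / 5 : ℝ) ^ 2 + (3 / 5) ^ 2 = 1 := by norm_num
  have hcs' : (4 / 5 : ℝ) ^ 2 + (-(3 / 5)) ^ 2 = 1 := by norm_num
  obtain ⟨κ, V, h0, e, e'⟩ := H.family2 (by norm_num) hcs
  have nX := fun j => H.normG1 (norm_zz j hcs)
  have hk : 4 / 5 ≤ κ := by
    have a := H.expa (norm_zz 0 hcs).le (norm_zz 1 hcs).le
    rw [e 0, e 1] at a
    have e1 : mkz (κ • uu G 0) 0 + V - (mkz (κ • uu G 1) 0 + V) = mkz (κ • (uu G 0 - uu G 1)) 0 := by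
      apply zext <;> simp [smul_sub]
    have n1 : ‖zz 0 (4 / 5) (3 / 5) - zz 1 (4 / 5) (3 / 5)‖ = 8 / 5 := by
      apply norm_eq_of_sq (by norm_num)
      simp only [zz, WithLp.sub_fst, WithLp.sub_snd, mkz_fst, mkz_snd]
      rw [norm_two zero_ne_one (fun n h1 h2 => by simp only [su_apply, sm_apply, ee_ne h1, ee_ne h2]; simp)]
      simp only [su_apply, sm_apply, ee_ne zero_ne_one, ee_ne one_ne_zero, ee_self]
      norm_num
    rw [e1, norm_mkz0, n1, norm_smul, Real.norm_eq_abs, abs_of_pos h0] at a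
    have b := norm_sub_le (uu G 0) (uu G 1)
    rw [H.u_norm, H.u_norm] at b
    nlinarith
  have e2 : G (zz 0 (4 / 5) (3 / 5)) - G (zz 0 (4 / 5) (-(3 / 5))) = (2 : ℝ) • V := by
    rw [e 0, e' 0, two_smul]; abel
  have V1 : ‖V‖ ≤ 1 := by
    have b := norm_sub_le (G (zz 0 (4 / 5) (3 / 5))) (G (zz 0 (4 / 5) (-(3 / 5))))
    rw [e2, norm_smul, H.normG1 (norm_zz 0 hcs), H.normG1 (norm_zz 0 hcs')] at b
    norm_num at b
    linarith
  have V2 : 3 / 5 ≤ ‖V‖ := by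
    have a := H.expa (norm_zz 0 hcs).le (norm_zz 0 hcs').le
    have n1 : ‖zz 0 (4 / 5) (3 / 5) - zz 0 (4 / 5) (-(3 / 5))‖ = 6 / 5 := by
      apply norm_eq_of_sq (by norm_num)
      simp only [zz, WithLp.sub_fst, WithLp.sub_snd, mkz_fst, mkz_snd]
      norm_num
    rw [e2, n1, norm_smul] at a
    norm_num at a
    linarith
  have V3 : 9 / 25 ≤ ‖V.fst‖ ^ 2 + V.snd ^ 2 := by
    rw [← nsq]; nlinarith
  have sq : ∀ j, ‖κ • uu G j + V.fst‖ ^ 2 + V.snd ^ 2 = 1 := by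
    intro j
    have := nsq (G (zz j (4 / 5) (3 / 5)))
    rw [nX, e j] at this
    simp only [WithLp.add_fst, WithLp.add_snd, mkz_fst, mkz_snd, zero_add, one_pow] at this
    exact this.symm
  have R : ∀ j, ‖κ • uu G j + V.fst‖ = ‖κ • uu G 0 + V.fst‖ := by
    intro j
    have := sq j
    have := sq 0
    exact (sq_eq_sq₀ (norm_nonneg _) (norm_nonneg _)).1 (by linarith)
  have nb := nu_bound V.fst (fun i : Fin 4 => uu G i) κ h0.le (fun i => H.u_norm i)
    (fun i j hij => H.u_disj (fun hh => hij (Fin.ext hh)))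
  rw [Finset.sum_congr rfl (fun (i : Fin 4) _ => R (i : ℕ))] at nb
  simp only [Finset.sum_const, Finset.card_univ, Fintype.card_fin, nsmul_eq_mul] at nb
  push_cast at nb
  have v0 := real2 hk (norm_nonneg V.fst) (by linarith) (sq 0) V3 ((fst_le V).trans V1)
  have v0' : V.fst = 0 := norm_eq_zero.1 v0
  have s0 := sq 0
  rw [v0', add_zero, norm_smul, H.u_norm, Real.norm_eq_abs, abs_of_pos h0, mul_one] at s0
  rw [v0] at V3
  have hk2 : κ = 4 / 5 := by apply le_antisymm _ hk; nlinarith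
  have hV2 : (V.snd - 3 / 5) * (V.snd + 3 / 5) = 0 := by rw [hk2] at s0; linarith
  obtain ⟨η, hη, hV⟩ : ∃ η : ℝ, (η = 1 ∨ η = -1) ∧ V.snd = η * (3 / 5) := by
    rcases mul_eq_zero.1 hV2 with hh | hh
    · exact ⟨1, by simp, by linarith⟩
    · exact ⟨-1, by simp, by linarith⟩
  refine ⟨η, hη, ?_, ?_⟩
  · rw [e 0, hk2]; apply zext <;> simp [v0', hV]
  · rw [e' 0, hk2]; apply zext <;> simp [v0', hV]

lemma axis : ∃ η : ℝ, (η = 1 ∨ η = -1) ∧ ∀ m, |m| ≤ 1 → F (mkz 0 (η * m)) = mkz 0 m := by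
  obtain ⟨η, hη, e1, e2⟩ := H.axis0
  have hcs : (4 / 5 : ℝ) ^ 2 + (3 / 5) ^ 2 = 1 := by norm_num
  have hcs' : (4 / 5 : ℝ) ^ 2 + (-(3 / 5)) ^ 2 = 1 := by norm_num
  have hcs2 : (-(4 / 5) : ℝ) ^ 2 + (3 / 5) ^ 2 = 1 := by norm_num
  refine ⟨η, hη, ?_⟩
  have o := H.odd 0 hcs'
  rw [neg_neg, e2] at o
  have N1 := norm_zz 0 hcs
  have N2 := norm_zz 0 hcs2
  have F1 := H.FG _ N1.le
  have F2 := H.FG _ N2.le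
  have m1 := H.mG _ N1.le
  have m2 := H.mG _ N2.le
  rw [e1] at F1 m1
  rw [o] at F2 m2
  have k := H.seg_ext m1 m2 (by
    rw [F1, F2]
    have : mkz ((4 / 5 : ℝ) • uu G 0) (η * (3 / 5)) - -mkz ((4 / 5 : ℝ) • uu G 0) (-(η * (3 / 5)))
      = mkz ((8 / 5 : ℝ) • uu G 0) 0 := by
      apply zext
      · simp only [WithLp.add_fst, mkz_fst, sub_neg_eq_add]
        rw [← add_smul]; norm_num
      · simp
    have t2 : zz 0 (4 / 5) (3 / 5) - zz 0 (-(4 / 5)) (3 / 5) = mkz ((8 / 5 : ℝ) • ee 0) 0 := by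
      apply zext
      · simp only [zz, WithLp.sub_fst, mkz_fst, neg_smul, sub_neg_eq_add, ← add_smul]; norm_num
      · simp [zz]
    rw [this, t2, norm_mkz0, norm_mkz0, norm_smul, norm_smul, H.u_norm, norm_ee]) (l := 1 / 2)
    (by norm_num) (by norm_num) F1 F2
  have c1 : (1 - 1 / 2 : ℝ) • mkz ((4 / 5 : ℝ) • uu G 0) (η * (3 / 5)) +
      (1 / 2 : ℝ) • -mkz ((4 / 5 : ℝ) • uu G 0) (-(η * (3 / 5))) = mkz 0 (η * (3 / 5)) := by
    apply zext
    · simp only [WithLp.add_fst, WithLp.smul_fst, WithLp.neg_fst, mkz_fst, smul_neg, smul_smul,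
        ← neg_smul, ← add_smul]
      norm_num
    · simp only [WithLp.add_snd, WithLp.smul_snd, WithLp.neg_snd, mkz_snd, smul_eq_mul]; ring
  rw [c1] at k
  have U : (0 : ℝ) ^ 2 + 1 ^ 2 = 1 := by norm_num
  have ho := H.homog 0 (t := 3 / 5) U (by norm_num) (by norm_num)
  have c2 : zz 0 ((1 - 1 / 2) * (4 / 5) + 1 / 2 * -(4 / 5)) ((1 - 1 / 2) * (3 / 5) + 1 / 2 * (3 / 5))
      = (3 / 5 : ℝ) • zz 0 0 1 := by
    rw [zz_smul]; congr 1 <;> norm_num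
  rw [c2, ← ho] at k
  have η2 : |η| = 1 := by rcases hη with h | h <;> rw [h] <;> norm_num
  have k2 := H.inj (by
    apply norm_le_of_sq (by norm_num)
    rw [mkz_fst, mkz_snd, norm_zero, mul_pow, ← sq_abs η, η2]; norm_num)
    (unit_smul (by norm_num) (by norm_num) (H.mG _ (norm_zz 0 U).le)) k
  have k3 : G (zz 0 0 1) = mkz 0 η := by
    have := congrArg (fun z : Z => (5 / 3 : ℝ) • z) k2
    simp only [smul_smul] at this
    norm_num at this
    rw [← this]
    apply zext
    · simp
    · simp only [WithLp.smul_snd, mkz_snd, smul_eq_mul]; ring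
  have k4 : G (zz 0 0 (-1)) = mkz 0 (-η) := by
    have := H.odd 0 U
    rw [neg_zero, k3] at this
    rw [this]; apply zext <;> simp
  intro m hm
  rw [abs_le] at hm
  rcases le_total 0 m with h0 | h0
  · have := H.homog 0 U h0 hm.2
    rw [k3] at this
    convert this using 2
    · apply zext <;> simp [mul_comm]
    · apply zext <;> simp [zz]
  · have := H.homog 0 (c := 0) (s := -1) (by norm_num) (t := -m) (by linarith) (by linarith)
    rw [k4] at this
    convert this using 2
    · apply zext <;> simp [mul_comm]
    · apply zext <;> simp [zz]

end Hyp

lemma norm_disj {x y : Ell1} (hd : ∀ n, x n = 0 ∨ y n = 0) : ‖x + y‖ = ‖x‖ + ‖y‖ := by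
  refine (l1_hasSum (x + y)).unique ?_
  convert (l1_hasSum x).add (l1_hasSum y) using 2 with n
  rcases hd n with h | h <;> simp [ad_apply, h]

lemma ee_disj {i j : ℕ} (hij : i ≠ j) (n : ℕ) : ee i n = 0 ∨ ee j n = 0 := by
  by_cases hn : n = i
  · right; exact ee_ne (by rw [hn]; exact hij)
  · left; exact ee_ne hn

noncomputable def LL (f : ℕ → Ell1) (i j : ℕ) (d d' a b : ℝ) : Z :=
  mkz ((a * d) • f i + (b * d') • f j) 0

lemma LL_sub (f : ℕ → Ell1) (i j : ℕ) (d d' a b a' b' : ℝ) :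
    LL f i j d d' a b - LL f i j d d' a' b' = LL f i j d d' (a - a') (b - b') := by
  apply zext
  · simp only [LL, WithLp.sub_fst, mkz_fst]; module
  · simp [LL]

lemma LL_smul (f : ℕ → Ell1) (i j : ℕ) (d d' a b t : ℝ) :
    t • LL f i j d d' a b = LL f i j d d' (t * a) (t * b) := by
  apply zext
  · simp only [LL, WithLp.smul_fst, mkz_fst]; module
  · simp [LL]

lemma norm_LL {f : ℕ → Ell1} {i j : ℕ} {d d' a b : ℝ} (hd : d = 1 ∨ d = -1) (hd' : d' = 1 ∨ d' = -1)
    (h1 : ‖f i‖ = 1) (h2 : ‖f j‖ = 1) (h3 : ∀ n, f i n = 0 ∨ f j n = 0) :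
    ‖LL f i j d d' a b‖ = |a| + |b| := by
  have ad : |d| = 1 := by rcases hd with h | h <;> rw [h] <;> norm_num
  have ad' : |d'| = 1 := by rcases hd' with h | h <;> rw [h] <;> norm_num
  rw [LL, norm_mkz0, norm_disj, norm_smul, norm_smul, h1, h2, Real.norm_eq_abs, Real.norm_eq_abs,
    abs_mul, abs_mul, ad, ad']
  · ring
  · intro n
    rcases h3 n with h | h <;> simp [sm_apply, h]

lemma LLe_i {i j : ℕ} (hij : i ≠ j) (d d' a b : ℝ) : (LL ee i j d d' a b).fst i = a * d := by
  simp [LL, ad_apply, sm_apply, ee_self, ee_ne hij]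
lemma LLe_j {i j : ℕ} (hij : i ≠ j) (d d' a b : ℝ) : (LL ee i j d d' a b).fst j = b * d' := by
  simp [LL, ad_apply, sm_apply, ee_self, ee_ne hij.symm]

lemma btw1 {x m d : ℝ} (hm : 0 ≤ m) (hd : d = 1 ∨ d = -1) (hx : |x| + |x - m * d| = |m * d|) :
    0 ≤ d * x ∧ |x| = d * x := by
  have key : 0 ≤ d * x := by
    rcases hd with h | h
    · subst h
      rw [mul_one, abs_of_nonneg hm] at hx
      have := neg_abs_le (x - m)
      have := neg_abs_le x
      linarith
    · subst h
      rw [show m * -1 = - m by ring, abs_neg, abs_of_nonneg hm] at hx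
      have := le_abs_self (x - -m)
      have := le_abs_self x
      linarith
  refine ⟨key, ?_⟩
  rcases hd with h | h <;> subst h
  · rw [one_mul]; exact abs_of_nonneg (by linarith)
  · rw [neg_one_mul]; exact abs_of_nonpos (by linarith)

namespace Hyp
variable {F G : Z → Z} (H : Hyp F G)
include H

lemma norm_D {i j : ℕ} (hij : i ≠ j) {d d' : ℝ} (hd : d = 1 ∨ d = -1) (hd' : d' = 1 ∨ d' = -1)
    (a b : ℝ) : ‖LL (uu G) i j d d' a b‖ = |a| + |b| :=
  norm_LL hd hd' (H.u_norm i) (H.u_norm j) (H.u_disj hij)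

omit H in
lemma norm_E {i j : ℕ} (hij : i ≠ j) {d d' : ℝ} (hd : d = 1 ∨ d = -1) (hd' : d' = 1 ∨ d' = -1)
    (a b : ℝ) : ‖LL ee i j d d' a b‖ = |a| + |b| :=
  norm_LL hd hd' (norm_ee i) (norm_ee j) (ee_disj hij)

lemma ps {i j : ℕ} (hij : i ≠ j) {d d' : ℝ} (hd : d = 1 ∨ d = -1) (hd' : d' = 1 ∨ d' = -1)
    {a b : ℝ} (ha : 0 ≤ a) (hb : 0 ≤ b) (hab : a + b ≤ 1) :
    ∃ p q : ℝ, 0 ≤ p ∧ 0 ≤ q ∧ p - q = a - b ∧ p ≤ a ∧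
      F (LL (uu G) i j d d' a b) = LL ee i j d d' p q := by
  obtain ⟨p, q, hp, hq, hpq, e⟩ := H.pairseg hij hd hd' (c := 1) (s := 0) (by norm_num)
    (by norm_num) ha hb hab
  have e1 : a • G (zz i (d * 1) 0) + b • G (zz j (d' * 1) (-0)) = LL (uu G) i j d d' a b := by
    rw [mul_one, mul_one, neg_zero, H.G_u i hd, H.G_u j hd']
    apply zext
    · simp only [LL, WithLp.add_fst, WithLp.smul_fst, mkz_fst]; module
    · simp [LL]
  rw [e1, mul_one, mul_one, mul_zero] at e
  have n := H.normF (v := LL (uu G) i j d d' a b) (by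
    rw [H.norm_D hij hd hd', abs_of_nonneg ha, abs_of_nonneg hb]; exact hab)
  have e2 : F (LL (uu G) i j d d' a b) = LL ee i j d d' p q := e
  rw [e2, H.norm_D hij hd hd', norm_E hij hd hd', abs_of_nonneg ha, abs_of_nonneg hb,
    abs_of_nonneg hp, abs_of_nonneg hq] at n
  exact ⟨p, q, hp, hq, hpq, by linarith, e2⟩

lemma two1 {i j : ℕ} (hij : i ≠ j) {d d' : ℝ} (hd : d = 1 ∨ d = -1) (hd' : d' = 1 ∨ d' = -1)
    {a b : ℝ} (ha : 0 ≤ a) (hb : 0 ≤ b) (hab : a + b = 1) :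
    F (LL (uu G) i j d d' a b) = LL ee i j d d' a b := by
  have hd1 : d * d = 1 := by rcases hd with h | h <;> rw [h] <;> norm_num
  have hd1' : d' * d' = 1 := by rcases hd' with h | h <;> rw [h] <;> norm_num
  have nE := norm_E hij hd hd'
  have nD := H.norm_D hij hd hd'
  have ny : ‖LL ee i j d d' a b‖ = 1 := by
    rw [nE, abs_of_nonneg ha, abs_of_nonneg hb, hab]
  obtain ⟨u, hu⟩ : ∃ u, u = G (LL ee i j d d' a b) := ⟨_, rfl⟩
  have nu : ‖u‖ = 1 := by rw [hu]; exact H.normG1 ny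
  have Fu : F u = LL ee i j d d' a b := by rw [hu]; exact H.FG _ ny.le
  obtain ⟨τ, τ', hτ, -, hττ, -, eτ⟩ := H.ps hij hd hd' (a := 1 / 4) (b := 1 / 4) (by norm_num)
    (by norm_num) (by norm_num)
  have : τ' = τ := by linarith
  subst this
  have τp : 0 < τ' := by
    refine lt_of_le_of_ne hτ ?_
    rintro rfl
    have e0 : LL ee i j d d' 0 0 = F 0 := by
      rw [H.F0]; apply zext <;> simp [LL]
    rw [e0] at eτ
    have := H.inj (by rw [nD]; norm_num) (by simp) eτ
    have h2 := nD (1 / 4) (1 / 4)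
    rw [this] at h2; norm_num at h2
  obtain ⟨t, ht⟩ : ∃ t, t = min (τ' / 2) (1 / 2) := ⟨_, rfl⟩
  have t0 : 0 < t := by rw [ht]; apply lt_min <;> linarith
  have t1 : t ≤ τ' / 2 := by rw [ht]; exact min_le_left _ _
  have t2 : t ≤ 1 / 2 := by rw [ht]; exact min_le_right _ _
  obtain ⟨W, hW⟩ : ∃ W, W = F ((1 - t) • (0 : Z) + t • u) := ⟨_, rfl⟩
  obtain ⟨b1, b2, b3⟩ := H.seg (P := 0) (Q := u) (by simp) nu.le (by
    rw [Fu, H.F0, zero_sub, zero_sub, norm_neg, norm_neg, ny, nu]) t0.le (by linarith) hW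
  rw [smul_zero, zero_add] at hW
  rw [H.F0, Fu] at b1 b2 b3
  have ci := b3 i
  have cj := b3 j
  have c0 : ∀ n, n ≠ i → n ≠ j → W.fst n = 0 := by
    intro n hn hn'
    have := b3 n
    simp only [LL, mkz_fst, WithLp.zero_fst, ze_apply, ad_apply, sm_apply, ee_ne hn, ee_ne hn', mul_zero,
      sub_zero, abs_zero, add_zero] at this
    exact abs_eq_zero.1 (by linarith)
  have b2' : ‖W.fst‖ = t := by
    have : ‖(LL ee i j d d' a b).fst‖ = 1 := by rw [← ny]; exact (norm_mkz0 _).symm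
    rw [WithLp.zero_fst, sub_zero, zero_sub, norm_neg, this, mul_one] at b2
    exact b2
  simp only [WithLp.zero_fst, ze_apply, sub_zero, zero_sub, abs_neg, LLe_i hij, LLe_j hij] at ci cj
  obtain ⟨w1p, w1a⟩ := btw1 ha hd ci
  obtain ⟨w2p, w2a⟩ := btw1 hb hd' cj
  rw [norm_two hij c0, w1a, w2a] at b2'
  obtain ⟨w1, hw1⟩ : ∃ w, w = d * W.fst i := ⟨_, rfl⟩
  obtain ⟨w2, hw2⟩ : ∃ w, w = d' * W.fst j := ⟨_, rfl⟩
  have eW : W = LL ee i j d d' w1 w2 := by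
    apply zext
    · ext n
      by_cases hn : n = i
      · subst hn; rw [LLe_i hij, hw1]; linear_combination (- W.fst n) * hd1
      · by_cases hn' : n = j
        · subst hn'; rw [LLe_j hij, hw2]; linear_combination (- W.fst n) * hd1'
        · rw [c0 n hn hn']; simp [LL, ad_apply, sm_apply, ee_ne hn, ee_ne hn']
    · rw [b1]; simp [LL]
  rw [← hw1, ← hw2] at b2'
  rw [← hw1] at w1p
  rw [← hw2] at w2p
  have bd : ∀ σ ∈ Set.Icc (0 : ℝ) (1 / 4), ‖LL (uu G) i j d d' (w1 + σ) (w2 + σ)‖ ≤ 1 := by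
    intro σ hσ
    rw [nD, abs_of_nonneg (by linarith [hσ.1]), abs_of_nonneg (by linarith [hσ.1])]
    linarith [hσ.2]
  have cont : ContinuousOn (fun σ : ℝ => d * (F (LL (uu G) i j d d' (w1 + σ) (w2 + σ))).fst i)
      (Set.Icc 0 (1 / 4)) := by
    refine continuousOn_const.mul (H.cont_coord ?_ bd i)
    have : (fun σ : ℝ => LL (uu G) i j d d' (w1 + σ) (w2 + σ)) =
        fun σ : ℝ => LL (uu G) i j d d' w1 w2 + σ • LL (uu G) i j d d' 1 1 := by
      funext σ
      apply zext
      · simp only [LL, WithLp.add_fst, WithLp.smul_fst, mkz_fst]; module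
      · simp [LL]
    rw [this]; fun_prop
  have key : ∀ σ ∈ Set.Icc (0 : ℝ) (1 / 4), ∃ p q : ℝ, 0 ≤ p ∧ 0 ≤ q ∧ p - q = w1 - w2 ∧ p ≤ w1 + σ ∧
      F (LL (uu G) i j d d' (w1 + σ) (w2 + σ)) = LL ee i j d d' p q ∧
      d * (F (LL (uu G) i j d d' (w1 + σ) (w2 + σ))).fst i = p := by
    intro σ hσ
    obtain ⟨p, q, hp, hq, hpq, hpa, e⟩ := H.ps hij hd hd' (a := w1 + σ) (b := w2 + σ)
      (by linarith [hσ.1]) (by linarith [hσ.1]) (by linarith [hσ.2])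
    refine ⟨p, q, hp, hq, by linarith, hpa, e, ?_⟩
    rw [e, LLe_i hij]; linear_combination p * hd1
  have iv := intermediate_value_Icc (by norm_num) cont
  have hm : w1 ∈ Set.Icc (d * (F (LL (uu G) i j d d' (w1 + 0) (w2 + 0))).fst i)
      (d * (F (LL (uu G) i j d d' (w1 + 1 / 4) (w2 + 1 / 4))).fst i) := by
    obtain ⟨p, q, -, -, -, h4, -, h6⟩ := key 0 (by norm_num)
    obtain ⟨p', q', hp', hq', -, -, h5, h6'⟩ := key (1 / 4) (by norm_num)
    rw [h6, h6']
    refine ⟨by linarith, ?_⟩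
    have L := H.lip _ _ (bd (1 / 4) (by norm_num)) (show ‖LL (uu G) i j d d' (1 / 4) (1 / 4)‖ ≤ 1 by
      rw [nD]; norm_num)
    rw [h5, eτ, LL_sub, LL_sub, nE, nD, add_sub_cancel_right, add_sub_cancel_right,
      abs_of_nonneg w1p, abs_of_nonneg w2p] at L
    have := neg_abs_le (p' - τ')
    have := abs_nonneg (q' - τ')
    linarith
  obtain ⟨σ, hσ, es⟩ := iv hm
  obtain ⟨p, q, h1, h2, h3, h4, h5, h6⟩ := key σ hσ
  have pw : p = w1 := h6.symm.trans es
  have qw : q = w2 := by linarith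
  rw [pw, qw, ← eW, hW] at h5
  have h7 := H.inj (bd σ hσ) (unit_smul t0.le (by linarith) nu.le) h5
  have h8 : u = LL (uu G) i j d d' (t⁻¹ * (w1 + σ)) (t⁻¹ * (w2 + σ)) := by
    rw [← LL_smul, h7, smul_smul, inv_mul_cancel₀ t0.ne', one_smul]
  obtain ⟨x, hx⟩ : ∃ x, x = t⁻¹ * (w1 + σ) := ⟨_, rfl⟩
  obtain ⟨y, hy⟩ : ∃ x, x = t⁻¹ * (w2 + σ) := ⟨_, rfl⟩
  have x0 : 0 ≤ x := by rw [hx]; have := hσ.1; positivity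
  have y0 : 0 ≤ y := by rw [hy]; have := hσ.1; positivity
  rw [← hx, ← hy] at h8
  have xy : x + y = 1 := by rw [← nu, h8, nD, abs_of_nonneg x0, abs_of_nonneg y0]
  obtain ⟨p, q, hp, hq, hpq, hpa, e⟩ := H.ps hij hd hd' x0 y0 xy.le
  rw [← h8, Fu] at e
  have e1 := congrArg (fun z : Z => z.fst i) e
  have e2 := congrArg (fun z : Z => z.fst j) e
  simp only [LLe_i hij, LLe_j hij] at e1 e2
  have dn : d ≠ 0 := by intro h; rw [h] at hd1; simp at hd1
  have dn' : d' ≠ 0 := by intro h; rw [h] at hd1'; simp at hd1'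
  have e3 := mul_right_cancel₀ dn e1
  have e4 := mul_right_cancel₀ dn' e2
  have hxa : x = a := by linarith
  have hyb : y = b := by linarith
  rw [hxa, hyb] at h8
  rw [← h8, Fu]

lemma two {i j : ℕ} (hij : i ≠ j) {d d' : ℝ} (hd : d = 1 ∨ d = -1) (hd' : d' = 1 ∨ d' = -1)
    {a b : ℝ} (ha : 0 ≤ a) (hb : 0 ≤ b) (hab : a + b ≤ 1) :
    F (LL (uu G) i j d d' a b) = LL ee i j d d' a b := by
  have nE := norm_E hij hd hd'
  have nD := H.norm_D hij hd hd'
  obtain ⟨p, q, hp, hq, hpq, hpa, e⟩ := H.ps hij hd hd' ha hb hab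
  obtain ⟨σ, hσ⟩ : ∃ σ, σ = (1 - a - b) / 2 := ⟨_, rfl⟩
  have s0 : 0 ≤ σ := by linarith
  have e2 := H.two1 hij hd hd' (a := a + σ) (b := b + σ) (by linarith) (by linarith) (by linarith)
  have L := H.lip (LL (uu G) i j d d' (a + σ) (b + σ)) (LL (uu G) i j d d' a b)
    (by rw [nD, abs_of_nonneg (by linarith), abs_of_nonneg (by linarith)]; linarith)
    (by rw [nD, abs_of_nonneg ha, abs_of_nonneg hb]; linarith)
  rw [e, e2, LL_sub, LL_sub, nE, nD, add_sub_cancel_left, add_sub_cancel_left, abs_of_nonneg s0] at L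
  have := le_abs_self (a + σ - p)
  have := le_abs_self (b + σ - q)
  have h1 : p = a := by linarith
  have h2 : q = b := by linarith
  rw [e, h1, h2]

end Hyp

lemma sum_app (s : Finset ℕ) (f : ℕ → Ell1) (n : ℕ) : (∑ k ∈ s, f k) n = ∑ k ∈ s, f k n := by
  rw [lp.coeFn_sum, Finset.sum_apply]

lemma sumE_mem {s : Finset ℕ} {a : ℕ → ℝ} {n : ℕ} (hn : n ∈ s) : (∑ k ∈ s, a k • ee k) n = a n := by
  rw [sum_app, Finset.sum_eq_single n]
  · simp [sm_apply, ee_self]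
  · intro b _ hb; simp [sm_apply, ee_ne hb.symm]
  · intro h; exact absurd hn h

lemma sumE_nmem {s : Finset ℕ} {a : ℕ → ℝ} {n : ℕ} (hn : n ∉ s) : (∑ k ∈ s, a k • ee k) n = 0 := by
  rw [sum_app]
  apply Finset.sum_eq_zero
  intro k hk
  simp [sm_apply, ee_ne (show n ≠ k by rintro rfl; exact hn hk)]

lemma ex_sign (a : ℝ) : ∃ d : ℝ, (d = 1 ∨ d = -1) ∧ |a| * d = a := by
  rcases le_total 0 a with h | h
  · exact ⟨1, by simp, by rw [abs_of_nonneg h, mul_one]⟩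
  · exact ⟨-1, by simp, by rw [abs_of_nonpos h]; ring⟩

noncomputable def SS (f : ℕ → Ell1) (s : Finset ℕ) (a : ℕ → ℝ) : Z := mkz (∑ k ∈ s, a k • f k) 0

lemma norm_SS_le {f : ℕ → Ell1} (hf : ∀ i, ‖f i‖ = 1) (s : Finset ℕ) (a : ℕ → ℝ) :
    ‖SS f s a‖ ≤ ∑ k ∈ s, |a k| := by
  rw [SS, norm_mkz0]
  refine (norm_sum_le _ _).trans (le_of_eq ?_)
  apply Finset.sum_congr rfl
  intro k _
  rw [norm_smul, hf, mul_one, Real.norm_eq_abs]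

lemma SS_erase {f : ℕ → Ell1} {s : Finset ℕ} {a : ℕ → ℝ} {i : ℕ} (hi : i ∈ s) :
    SS f s a = mkz (a i • f i) 0 + SS f (s.erase i) a := by
  apply zext
  · simp only [SS, WithLp.add_fst, mkz_fst]; rw [Finset.add_sum_erase s (fun k => a k • f k) hi]
  · simp [SS]

namespace Hyp
variable {F G : Z → Z} (H : Hyp F G)
include H

lemma one (i : ℕ) {a : ℝ} (ha : |a| ≤ 1) : F (mkz (a • uu G i) 0) = mkz (a • ee i) 0 := by
  obtain ⟨d, hd, e⟩ := ex_sign a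
  have := H.two (Nat.succ_ne_self i).symm hd (d' := 1) (by simp) (abs_nonneg a) le_rfl (by linarith)
  simpa [LL, e] using this

lemma two' {i j : ℕ} (hij : i ≠ j) {a b : ℝ} (hab : |a| + |b| ≤ 1) :
    F (mkz (a • uu G i + b • uu G j) 0) = mkz (a • ee i + b • ee j) 0 := by
  obtain ⟨d, hd, e⟩ := ex_sign a
  obtain ⟨d', hd', e'⟩ := ex_sign b
  have := H.two hij hd hd' (abs_nonneg a) (abs_nonneg b) hab
  simpa [LL, e, e'] using this

lemma step1 {s : Finset ℕ} {a : ℕ → ℝ} {i : ℕ} (hi : i ∈ s) (hai : a i ≠ 0)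
    (hS : ∑ k ∈ s, |a k| ≤ 1) (hJ : 0 < ∑ k ∈ s.erase i, |a k|)
    (ih : ∀ b : ℕ → ℝ, ∑ k ∈ s.erase i, |b k| ≤ 1 → F (SS (uu G) (s.erase i) b) = SS ee (s.erase i) b)
    {W : Z} (hW : W = F (SS (uu G) s a)) :
    W.snd = 0 ∧ (∀ n ∉ s, W.fst n = 0) ∧
    2 * |W.fst i| = ∑ k ∈ s, |W.fst k| - ∑ k ∈ s, |a k| + 2 * |a i| ∧
    ∃ d : ℝ, |a i| * d = a i ∧ |W.fst i| * d = W.fst i := by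
  obtain ⟨d, hd, ed⟩ := ex_sign (a i)
  have hd1 : d * d = 1 := by rcases hd with h | h <;> rw [h] <;> norm_num
  have ad : |d| = 1 := by rcases hd with h | h <;> rw [h] <;> norm_num
  have hm : 0 < |a i| := abs_pos.2 hai
  obtain ⟨S, eS⟩ : ∃ S, S = ∑ k ∈ s, |a k| := ⟨_, rfl⟩
  obtain ⟨T, eT⟩ : ∃ T, T = ∑ k ∈ s.erase i, |a k| := ⟨_, rfl⟩
  have eST : S = |a i| + T := by rw [eS, eT, Finset.add_sum_erase s (fun k => |a k|) hi]
  rw [← eS] at hS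
  rw [← eT] at hJ
  have S0 : 0 < S := by linarith
  have sb : ∑ k ∈ s.erase i, |S / T * a k| = S := by
    simp only [abs_mul]
    rw [← Finset.mul_sum, ← eT, abs_of_pos (by positivity)]; field_simp
  have FQ := ih (fun k => S / T * a k) (by rw [sb]; exact hS)
  have aSd : |S * d| = S := by rw [abs_mul, ad, abs_of_pos S0, mul_one]
  have FP := H.one i (a := S * d) (by rw [aSd]; exact hS)
  have nP : ‖mkz ((S * d) • uu G i) 0‖ = S := by
    rw [norm_mkz0, norm_smul, H.u_norm, Real.norm_eq_abs, aSd, mul_one]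
  have nQ : ‖SS (uu G) (s.erase i) (fun k => S / T * a k)‖ ≤ S :=
    (norm_SS_le H.u_norm _ _).trans sb.le
  have e1 : (1 - T / S) • mkz ((S * d) • uu G i) 0 +
      (T / S) • SS (uu G) (s.erase i) (fun k => S / T * a k) = SS (uu G) s a := by
    rw [SS_erase hi]
    congr 1
    · apply zext
      · simp only [WithLp.smul_fst, mkz_fst, smul_smul]
        congr 1
        rw [← ed]; field_simp; linear_combination d * eST
      · simp
    · apply zext
      · simp only [SS, WithLp.smul_fst, mkz_fst, Finset.smul_sum, smul_smul]
        apply Finset.sum_congr rfl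
        intro k _
        congr 1
        field_simp
      · simp [SS]
  have nfp : ‖((S * d) • ee i) - ∑ k ∈ s.erase i, (S / T * a k) • ee k‖ = 2 * S := by
    rw [norm_fin s, ← Finset.add_sum_erase s _ hi]
    · have t1 : |((S * d) • ee i - ∑ k ∈ s.erase i, (S / T * a k) • ee k) i| = S := by
        rw [su_apply, sumE_nmem (a := fun k => S / T * a k) (Finset.notMem_erase i s), sm_apply, ee_self, mul_one, sub_zero, aSd]
      rw [t1, two_mul]; congr 1
      refine Eq.trans ?_ sb
      apply Finset.sum_congr rfl
      intro k hk
      rw [su_apply, sumE_mem (a := fun k => S / T * a k) hk, sm_apply, ee_ne (Finset.ne_of_mem_erase hk)]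
      simp
    · intro n hn
      rw [su_apply, sumE_nmem (a := fun k => S / T * a k) (fun h => hn (Finset.mem_of_mem_erase h)), sm_apply,
        ee_ne (show n ≠ i by rintro rfl; exact hn hi)]
      simp
  obtain ⟨b1, b2, b3⟩ := H.seg (nP.le.trans hS) (nQ.trans hS) (by
    rw [FP, FQ]
    refine (norm_sub_le _ _).trans ?_
    have : mkz ((S * d) • ee i) 0 - SS ee (s.erase i) (fun k => S / T * a k) =
      mkz (((S * d) • ee i) - ∑ k ∈ s.erase i, (S / T * a k) • ee k) 0 := by
      apply zext <;> simp [SS]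
    rw [this, nP, norm_mkz0, nfp]; linarith) (l := T / S) (by positivity)
    (by rw [div_le_one S0]; linarith) (W := W) (by rw [e1, hW])
  rw [FP, FQ] at b1 b2 b3
  simp only [SS, mkz_fst, mkz_snd] at b1 b2 b3
  have c0 : ∀ n ∉ s, W.fst n = 0 := by
    intro n hn
    have := b3 n
    rw [sumE_nmem (a := fun k => S / T * a k) (fun h => hn (Finset.mem_of_mem_erase h)), sm_apply,
        ee_ne (show n ≠ i by rintro rfl; exact hn hi)] at this
    simp only [mul_zero, sub_zero, abs_zero] at this
    exact abs_eq_zero.1 (by linarith)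
  have ci := b3 i
  rw [sumE_nmem (a := fun k => S / T * a k) (Finset.notMem_erase i s), sm_apply, ee_self, mul_one,
    sub_zero, sub_zero, mul_comm S d] at ci
  obtain ⟨x1, x2, x3⟩ := btw0 S0 hd ci
  rw [nfp] at b2
  have b2' : ‖W.fst - (S * d) • ee i‖ = |W.fst i - d * S| + ∑ k ∈ s.erase i, |W.fst k| := by
    rw [norm_fin s, ← Finset.add_sum_erase s _ hi]
    · congr 1
      · rw [su_apply, sm_apply, ee_self, mul_one, mul_comm]
      · apply Finset.sum_congr rfl
        intro k hk
        rw [su_apply, sm_apply, ee_ne (Finset.ne_of_mem_erase hk), mul_zero, sub_zero]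
    · intro n hn
      rw [su_apply, sm_apply, ee_ne (show n ≠ i by rintro rfl; exact hn hi), c0 n hn]; simp
  rw [b2', x3] at b2
  have e3 : T / S * (2 * S) = 2 * T := by field_simp
  rw [e3] at b2
  refine ⟨by rw [b1]; ring, c0, ?_, d, ed, ?_⟩
  · rw [← Finset.add_sum_erase s (fun k => |W.fst k|) hi, ← eS, x2]
    linarith
  · rw [x2]; linear_combination W.fst i * hd1

lemma fin_aux : ∀ (N : ℕ) (s : Finset ℕ), s.card = N → ∀ a : ℕ → ℝ, ∑ k ∈ s, |a k| ≤ 1 →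
    F (SS (uu G) s a) = SS ee s a := by
  intro N
  induction N with
  | zero =>
    intro s hs a _
    rw [Finset.card_eq_zero] at hs
    subst hs
    have : ∀ f : ℕ → Ell1, SS f ∅ a = 0 := by intro f; apply zext <;> simp [SS]
    rw [this, this, H.F0]
  | succ N ih =>
    intro s hs a ha
    have ihE : ∀ i ∈ s, ∀ b : ℕ → ℝ, ∑ k ∈ s.erase i, |b k| ≤ 1 →
        F (SS (uu G) (s.erase i) b) = SS ee (s.erase i) b := by
      intro i hi
      exact ih _ (by rw [Finset.card_erase_of_mem hi, hs]; rfl)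
    by_cases hz : ∃ i ∈ s, a i = 0
    · obtain ⟨i, hi, hai⟩ := hz
      have e : ∀ f : ℕ → Ell1, SS f s a = SS f (s.erase i) a := by
        intro f
        rw [SS_erase hi, hai]
        apply zext <;> simp
      rw [e, e]
      apply ihE i hi
      refine le_trans (Finset.sum_le_sum_of_subset_of_nonneg (Finset.erase_subset _ _) ?_) ha
      intros; exact abs_nonneg _
    push Not at hz
    rcases Nat.lt_or_ge N 2 with hN | hN
    · interval_cases N
      · obtain ⟨i, rfl⟩ := Finset.card_eq_one.1 hs
        simp only [SS, Finset.sum_singleton] at ha ⊢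
        exact H.one i ha
      · obtain ⟨i, j, hij, rfl⟩ := Finset.card_eq_two.1 hs
        simp only [SS, Finset.sum_pair hij] at ha ⊢
        exact H.two' hij ha
    obtain ⟨W, hW⟩ : ∃ W, W = F (SS (uu G) s a) := ⟨_, rfl⟩
    have st := fun i (hi : i ∈ s) => H.step1 hi (hz i hi) ha (by
      have hne : (s.erase i).Nonempty := by
        rw [← Finset.card_pos, Finset.card_erase_of_mem hi]; omega
      apply Finset.sum_pos _ hne
      intro k hk
      exact abs_pos.2 (hz k (Finset.mem_of_mem_erase hk))) (ihE i hi) hW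
    have sm : ∑ i ∈ s, 2 * |W.fst i| =
        ∑ i ∈ s, (∑ k ∈ s, |W.fst k| - ∑ k ∈ s, |a k| + 2 * |a i|) :=
      Finset.sum_congr rfl (fun i hi => (st i hi).2.2.1)
    rw [Finset.sum_add_distrib, Finset.sum_const, ← Finset.mul_sum, ← Finset.mul_sum, hs,
      nsmul_eq_mul] at sm
    push_cast at sm
    have tot : ∑ k ∈ s, |W.fst k| - ∑ k ∈ s, |a k| = 0 := by
      have h1 : ((N : ℝ) - 1) * (∑ k ∈ s, |W.fst k| - ∑ k ∈ s, |a k|) = 0 := by linarith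
      refine (mul_eq_zero.1 h1).resolve_left ?_
      have : (2 : ℝ) ≤ N := by exact_mod_cast hN
      linarith
    obtain ⟨i0, hi0⟩ : s.Nonempty := by rw [← Finset.card_pos]; omega
    rw [← hW]
    apply zext
    · ext n
      by_cases hn : n ∈ s
      · obtain ⟨-, -, h3, d, h4, h5⟩ := st n hn
        rw [SS, mkz_fst, sumE_mem hn, ← h4, ← h5]
        congr 1
        linarith
      · rw [SS, mkz_fst, sumE_nmem hn, (st i0 hi0).2.1 n hn]
    · rw [(st i0 hi0).1]; simp [SS]

lemma fin_lin (s : Finset ℕ) (a : ℕ → ℝ) (ha : ∑ k ∈ s, |a k| ≤ 1) :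
    F (SS (uu G) s a) = SS ee s a := H.fin_aux _ s rfl a ha

end Hyp

noncomputable def TT (G : Z → Z) (w : Ell1) : Ell1 := ∑' i, w i • uu G i

namespace Hyp
variable {F G : Z → Z} (H : Hyp F G)
include H

lemma T_bd (w : Ell1) (i : ℕ) : ‖w i • uu G i‖ = |w i| := by
  rw [norm_smul, H.u_norm, mul_one, Real.norm_eq_abs]

lemma T_hasSum (w : Ell1) : HasSum (fun i => w i • uu G i) (TT G w) := by
  apply Summable.hasSum
  apply Summable.of_norm
  simp only [H.T_bd]
  exact (l1_hasSum w).summable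

lemma T_norm (w : Ell1) : ‖TT G w‖ ≤ ‖w‖ :=
  tsum_of_norm_bounded (l1_hasSum w) (fun i => (H.T_bd w i).le)

lemma T_smul (t : ℝ) (w : Ell1) : TT G (t • w) = t • TT G w := by
  refine (H.T_hasSum (t • w)).unique ?_
  have := (H.T_hasSum w).const_smul t
  simpa only [smul_smul, sm_apply] using this

lemma F_T {w : Ell1} (hw : ‖w‖ ≤ 1) : F (mkz (TT G w) 0) = mkz w 0 := by
  have h1 : Filter.Tendsto (fun s : Finset ℕ => ∑ i ∈ s, w i • uu G i) Filter.atTop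
    (nhds (TT G w)) := H.T_hasSum w
  have hs : HasSum (fun i => w i • ee i) w := by
    have := lp.hasSum_single (p := 1) (E := fun _ : ℕ => ℝ) (by simp) w
    convert this using 2 with i
    rw [ee, ← lp.single_smul]; simp
  have h2 : Filter.Tendsto (fun s : Finset ℕ => ∑ i ∈ s, w i • ee i) Filter.atTop (nhds w) := hs
  rw [tendsto_iff_norm_sub_tendsto_zero] at h1 h2
  have h3 := h1.add h2
  rw [add_zero] at h3
  have nT : ‖mkz (TT G w) 0‖ ≤ 1 := by rw [norm_mkz0]; exact (H.T_norm w).trans hw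
  have h4 : ‖F (mkz (TT G w) 0) - mkz w 0‖ ≤ 0 := by
    refine ge_of_tendsto' h3 (fun s => ?_)
    have hb : ∑ k ∈ s, |w k| ≤ 1 :=
      (sum_le_hasSum s (fun i _ => abs_nonneg (w i)) (l1_hasSum w)).trans hw
    have e := H.fin_lin s w hb
    have L := H.lip (mkz (TT G w) 0) (SS (uu G) s w) nT ((norm_SS_le H.u_norm s w).trans hb)
    rw [e] at L
    have e1 : ∀ x y : Ell1, ‖mkz x 0 - mkz y 0‖ = ‖y - x‖ := by
      intro x y
      rw [norm_sub_rev, ← norm_mkz0]; congr 1; apply zext <;> simp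
    have l1 := e1 (TT G w) (∑ i ∈ s, w i • uu G i)
    have l2 := e1 w (∑ i ∈ s, w i • ee i)
    have l3 := norm_sub_le_norm_sub_add_norm_sub (F (mkz (TT G w) 0)) (SS ee s w) (mkz w 0)
    rw [norm_sub_rev] at l2
    simp only [SS] at L l3
    linarith
  exact sub_eq_zero.1 (norm_le_zero_iff.1 h4)

lemma F_full {η : ℝ} (hη : η = 1 ∨ η = -1) (ax : ∀ m, |m| ≤ 1 → F (mkz 0 (η * m)) = mkz 0 m)
    {w : Ell1} {m : ℝ} (hw : ‖w‖ ≤ 1 / 2) (hm : |m| ≤ 1 / 2) :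
    F (mkz (TT G w) (η * m)) = mkz w m := by
  have η2 : η ^ 2 = 1 := by rcases hη with h | h <;> rw [h] <;> norm_num
  have hw2 : ‖(2 : ℝ) • w‖ = 2 * ‖w‖ := by rw [norm_smul]; norm_num
  have hm2 : |2 * m| = 2 * |m| := by rw [abs_mul]; norm_num
  have FP := H.F_T (w := (2 : ℝ) • w) (by linarith)
  have FQ := ax (2 * m) (by linarith)
  have nT : ‖TT G w‖ ≤ ‖w‖ := H.T_norm w
  have nT2 : ‖TT G ((2 : ℝ) • w)‖ ≤ ‖(2 : ℝ) • w‖ := H.T_norm _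
  have nP : ‖mkz (TT G ((2 : ℝ) • w)) 0‖ ≤ 1 := by rw [norm_mkz0]; linarith
  have am : m ^ 2 ≤ 1 / 4 := by rw [← sq_abs]; nlinarith [abs_nonneg m]
  have nQ : ‖mkz 0 (η * (2 * m))‖ ≤ 1 := by
    apply norm_le_of_sq (by norm_num)
    simp only [mkz_fst, mkz_snd, norm_zero]
    nlinarith
  obtain ⟨W, hW⟩ : ∃ W, W = F (mkz (TT G w) (η * m)) := ⟨_, rfl⟩
  have e1 : (1 - 1 / 2 : ℝ) • mkz (TT G ((2 : ℝ) • w)) 0 + (1 / 2 : ℝ) • mkz 0 (η * (2 * m)) =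
      mkz (TT G w) (η * m) := by
    rw [H.T_smul]
    apply zext
    · simp only [WithLp.add_fst, WithLp.smul_fst, mkz_fst, smul_smul, smul_zero, add_zero]; norm_num
    · simp only [WithLp.add_snd, WithLp.smul_snd, mkz_snd, smul_eq_mul]; ring
  obtain ⟨b1, -, -⟩ := H.seg nP nQ (by
    rw [FP, FQ]
    apply norm_le_of_sq (norm_nonneg _)
    rw [nsq]
    simp only [WithLp.sub_fst, WithLp.sub_snd, mkz_fst, mkz_snd, sub_zero, zero_sub]
    have := pow_le_pow_left₀ (norm_nonneg _) nT2 2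
    nlinarith) (l := 1 / 2) (by norm_num) (by norm_num) (W := W) (by rw [e1, hW])
  rw [FP, FQ] at b1
  simp only [mkz_snd] at b1
  have b1' : W.snd = m := by rw [b1]; ring
  have nw : ‖w‖ ^ 2 ≤ 1 / 4 := by nlinarith [norm_nonneg w]
  have nTs := pow_le_pow_left₀ (norm_nonneg _) nT 2
  have L := H.lip (mkz (TT G w) (η * m)) (mkz (TT G w) 0) (by
    apply norm_le_of_sq (by norm_num)
    simp only [mkz_fst, mkz_snd]
    nlinarith) (by rw [norm_mkz0]; linarith)
  rw [← hW, H.F_T (by linarith)] at L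
  have L2 := pow_le_pow_left₀ (norm_nonneg _) L 2
  rw [nsq, nsq] at L2
  simp only [WithLp.sub_fst, WithLp.sub_snd, mkz_fst, mkz_snd, sub_zero, sub_self, norm_zero, b1'] at L2
  have L3 : ‖W.fst - w‖ ^ 2 ≤ 0 := by nlinarith
  have L4 : ‖W.fst - w‖ = 0 := by
    have := sq_nonneg ‖W.fst - w‖
    exact pow_eq_zero_iff two_ne_zero |>.1 (le_antisymm L3 this)
  rw [← hW]
  apply zext
  · exact sub_eq_zero.1 (norm_eq_zero.1 L4)
  · exact b1'

lemma fwd {v : Z} (hv : ‖v‖ ≤ 1) (h0 : v.snd = 0) : (F v).snd = 0 := by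
  obtain ⟨η, hη, ax⟩ := H.axis
  have η0 : η ≠ 0 := by rcases hη with h | h <;> rw [h] <;> norm_num
  have n2 : ‖(1 / 2 : ℝ) • v‖ ≤ 1 / 2 := by rw [norm_smul]; norm_num; linarith
  have n3 := (H.normF (v := (1 / 2 : ℝ) • v) (by linarith)).trans n2
  obtain ⟨w, hw⟩ : ∃ w, w = F ((1 / 2 : ℝ) • v) := ⟨_, rfl⟩
  rw [← hw] at n3
  have a1 := (fst_le w).trans n3
  have a2 := (snd_le w).trans n3
  have e := H.F_full hη ax a1 a2
  have e1 : mkz w.fst w.snd = w := zext rfl rfl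
  rw [e1, hw] at e
  rw [← hw] at e
  have nT := (H.T_norm w.fst).trans a1
  have nTs := pow_le_pow_left₀ (norm_nonneg _) nT 2
  have η2 : η ^ 2 = 1 := by rcases hη with h | h <;> rw [h] <;> norm_num
  have a2s : w.snd ^ 2 ≤ 1 / 4 := by rw [← sq_abs]; nlinarith [abs_nonneg w.snd]
  have i := H.inj (v := mkz (TT G w.fst) (η * w.snd)) (w := (1 / 2 : ℝ) • v) (by
    apply norm_le_of_sq (by norm_num)
    simp only [mkz_fst, mkz_snd]
    nlinarith) (by linarith) (by rw [e, hw])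
  have i2 := congrArg (fun z : Z => z.snd) i
  simp only [mkz_snd, WithLp.smul_snd, h0, smul_zero] at i2
  have m0 := (mul_eq_zero.1 i2).resolve_left η0
  have i1 := congrArg (fun z : Z => z.fst) i
  simp only [mkz_fst, WithLp.smul_fst] at i1
  have ev : v = mkz (TT G ((2 : ℝ) • w.fst)) 0 := by
    apply zext
    · rw [mkz_fst, H.T_smul, i1, smul_smul]; norm_num
    · exact h0
  rw [ev, H.F_T]
  · rfl
  · rw [norm_smul]; norm_num; linarith

lemma bwd {v : Z} (hv : ‖v‖ ≤ 1) (h0 : v.snd = 0) : ∃ x : Z, ‖x‖ ≤ 1 ∧ x.snd = 0 ∧ F x = v := by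
  have n := (fst_le v).trans hv
  refine ⟨mkz (TT G v.fst) 0, ?_, rfl, ?_⟩
  · rw [norm_mkz0]; exact (H.T_norm _).trans n
  · rw [H.F_T n]; exact zext rfl h0.symm

end Hyp
end PlB

/-- If F is a non-expansive bijection of the closed unit ball of Z = ℓ₁ ⊕₂ ℝ
onto itself and L₀ = {z ∈ B_Z : h(z) = 0}, then F(L₀) = L₀ (equivalently,
F⁻¹(L₀) = L₀). -/
theorem image_of_hyperplane_section_ell1_sum2_real
    (B : Set Z) (hB : B = Metric.closedBall (0 : Z) 1)
    (L₀ : Set Z) (hL₀ : L₀ = {z ∈ B | h z = 0})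
    (F : Z → Z) (hbij : Set.BijOn F B B) (hne : LipschitzOnWith 1 F B) :
    F '' L₀ = L₀ := by
  subst hB
  have mem : ∀ v : Z, v ∈ Metric.closedBall (0 : Z) 1 ↔ ‖v‖ ≤ 1 := fun v => by simp
  have inv := hbij.invOn_invFunOn
  have H : PlB.Hyp F (Function.invFunOn F (Metric.closedBall (0 : Z) 1)) := by
    refine ⟨?_, ?_, ?_, ?_, ?_⟩
    · intro v hv
      exact (mem _).1 (hbij.mapsTo ((mem v).2 hv))
    · intro v hv
      exact (mem _).1 (hbij.surjOn.mapsTo_invFunOn ((mem v).2 hv))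
    · intro v hv
      exact inv.2 ((mem v).2 hv)
    · intro v hv
      exact inv.1 ((mem v).2 hv)
    · intro v w hv hw
      have := hne.dist_le_mul v ((mem v).2 hv) w ((mem w).2 hw)
      simpa [dist_eq_norm] using this
  have hh : ∀ z : Z, h z = z.snd := fun _ => rfl
  subst hL₀
  ext y
  constructor
  · rintro ⟨x, ⟨hx, hx0⟩, rfl⟩
    exact ⟨hbij.mapsTo hx, H.fwd ((mem x).1 hx) hx0⟩
  · rintro ⟨hy, hy0⟩
    obtain ⟨x, h1, h2, h3⟩ := H.bwd ((mem y).1 hy) hy0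
    exact ⟨x, ⟨(mem x).2 h1, h2⟩, h3⟩
end
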